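/- arXiv:2010.06031 — 3 statements merged into one kernel-verified Lean document; each statement's English description precedes it below -/
import Mathlib

section
/- Let (G,S) be an essential set-equipped graph, X = X(G,S), and B(t) its generating matrix. Then the zeta function of X satisfies ζ_X(t) = 1 / ((1 − t)^{p_1(X)} · det(I − B(t))), where p_1(X) is the number of fixed points of the shift map in X. -/
open Filter Topology

/-- The shift map on bi-infinite sequences over the alphabet `A`. -/
def shiftMap {A : Type*} (x : ℤ → A) : ℤ → A := fun i => x (i + 1)

/-- A finite word `w` appears (as a consecutive subsequence) in the bi-infinite
sequence `x`. -/
def Appears {A : Type*} (w : List A) (x : ℤ → A) : Prop :=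
  ∃ k : ℤ, ∀ i : Fin w.length, x (k + (i : ℕ)) = w.get i

/-- `w` belongs to the language of `X`: it appears in some point of `X`. -/
def InLanguage {A : Type*} (X : Set (ℤ → A)) (w : List A) : Prop :=
  ∃ x ∈ X, Appears w x

/-- `X` has topological entropy `h`, i.e. `(1/n) · log |B_n(X)| → h`. -/
def HasEntropy {A : Type*} (X : Set (ℤ → A)) (h : ℝ) : Prop :=
  Filter.Tendsto
    (fun n : ℕ => Real.log ({w : List A | w.length = n ∧ InLanguage X w}.ncard) / n)
    Filter.atTop (nhds h)

/-- The set of bi-infinite concatenations `⋯ u₋₁^{n₋₁} u₀^{n₀} u₁^{n₁} ⋯` with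
`uᵢ ∈ V`, `nᵢ ∈ S uᵢ` and `(uᵢ, uᵢ₊₁)` an edge of the graph.  The `S`-graph shift
`X(G,S)` is the closure of this set. -/
def SGraphCore {V : Type*} (Adj : V → V → Prop) (S : V → Set ℕ) : Set (ℤ → V) :=
  {x | ∃ (a : ℤ → V) (t : ℤ → ℤ), StrictMono t ∧
    (∀ i : ℤ, (t (i + 1) - t i).toNat ∈ S (a i)) ∧
    (∀ i : ℤ, Adj (a i) (a (i + 1))) ∧
    (∀ i k : ℤ, t i ≤ k → k < t (i + 1) → x k = a i) ∧
    (∀ m : ℤ, ∃ i : ℤ, t i ≤ m ∧ m < t (i + 1))}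

/-- The generating function `H_i(t) = ∑_{s ∈ S i} t^s` of a vertex `i`. -/
noncomputable def genFun {V : Type*} (S : V → Set ℕ) (i : V) (x : ℝ) : ℝ :=
  ∑' s : S i, x ^ (s : ℕ)

/-- The generating matrix `B(t)` of the set-equipped graph `(G, S)`. -/
noncomputable def genMatrix {V : Type*} (Adj : V → V → Prop) [DecidableRel Adj]
    (S : V → Set ℕ) (x : ℝ) : Matrix V V ℝ :=
  fun i j => if Adj i j then genFun S i x else 0

/-- `p_n(X)`: the number of points of `X` of period `n` under the shift map. -/
noncomputable def perCount {A : Type*} (X : Set (ℤ → A)) (n : ℕ) : ℕ :=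
  {x ∈ X | shiftMap^[n] x = x}.ncard

/-- The Leibniz rule for a finite product, with the derived factor substituted in place. -/
theorem Derivation.leibniz_prod_update {R A ι : Type*} [CommRing R] [CommRing A] [Algebra R A]
    [DecidableEq ι] (D : Derivation R A A) (s : Finset ι) (f : ι → A) :
    D (∏ i ∈ s, f i) = ∑ i ∈ s, ∏ j ∈ s, Function.update f i (D (f i)) j := by
  induction s using Finset.induction_on with
  | empty => simp
  | insert a s ha ih =>
    rw [Finset.prod_insert ha, D.leibniz, ih, Finset.sum_insert ha, Finset.prod_insert ha,
      Function.update_self, smul_eq_mul, smul_eq_mul, Finset.mul_sum, add_comm]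
    congr 1
    · rw [mul_comm]
      congr 1
      refine Finset.prod_congr rfl fun j hj => ?_
      rw [Function.update_of_ne (ne_of_mem_of_not_mem hj ha)]
    · refine Finset.sum_congr rfl fun i hi => ?_
      rw [Finset.prod_insert ha, Function.update_of_ne (ne_of_mem_of_not_mem hi ha).symm]

/-- **Jacobi's formula** for the derivative of a determinant. -/
theorem Derivation.map_det {R A n : Type*} [CommRing R] [CommRing A] [Algebra R A]
    [Fintype n] [DecidableEq n] (D : Derivation R A A) (M : Matrix n n A) :
    D M.det = (M.adjugate * M.map D).trace := by
  have key : D M.det = ∑ i, (M.updateCol i fun j => D (M j i)).det := by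
    simp only [Matrix.det_apply, map_sum]
    rw [Finset.sum_comm]
    refine Finset.sum_congr rfl fun σ _ => ?_
    rw [← Finset.smul_sum, Units.smul_def, Units.smul_def, map_zsmul, D.leibniz_prod_update]
    congr 1
    refine Finset.sum_congr rfl fun i _ => Finset.prod_congr rfl fun j _ => ?_
    by_cases h : j = i
    · subst h; simp
    · simp [h]
  rw [key]
  refine Finset.sum_congr rfl fun i _ => ?_
  rw [← Matrix.cramer_apply, Matrix.cramer_eq_adjugate_mulVec]
  rfl

open PowerSeries in
/-- The logarithmic derivative of `det (1 - tA)` is minus the generating series of the traces. -/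
theorem Matrix.derivative_det_one_sub_X_smul {n : Type*} [Fintype n] [DecidableEq n]
    (A : Matrix n n ℝ) :
    d⁄dX ℝ (1 - (X : ℝ⟦X⟧) • A.map (C (R := ℝ))).det =
      -((1 - (X : ℝ⟦X⟧) • A.map (C (R := ℝ))).det *
        PowerSeries.mk fun k => (A ^ (k + 1)).trace) := by
  set M := 1 - (X : ℝ⟦X⟧) • A.map (C (R := ℝ)) with hM
  let P : Matrix n n ℝ⟦X⟧ := fun i j => PowerSeries.mk fun k => (A ^ k) i j
  have hAP : ∀ i j, (A.map (C (R := ℝ)) * P) i j = PowerSeries.mk fun k => (A ^ (k + 1)) i j := by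
    intro i j
    ext k
    rw [Matrix.mul_apply, coeff_mk, pow_succ', Matrix.mul_apply, map_sum]
    simp [P]
  have hMP : M * P = 1 := by
    ext i j k
    rw [hM, Matrix.sub_mul, Matrix.one_mul, Matrix.smul_mul, Matrix.sub_apply, Matrix.smul_apply,
      hAP]
    cases k with
    | zero => simp [P, Matrix.one_apply]
    | succ k =>
      simp only [P, coeff_succ_X_mul, Matrix.one_apply, coeff_mk, smul_eq_mul, map_sub, sub_self]
      split_ifs <;> simp [coeff_one]
  have hadj : M.adjugate = M.det • P := by
    rw [← Matrix.mul_one M.adjugate, ← hMP, ← Matrix.mul_assoc, Matrix.adjugate_mul,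
      Matrix.smul_mul, Matrix.one_mul]
  have hD : M.map (d⁄dX ℝ) = -A.map (C (R := ℝ)) := by
    ext1 i j
    have h1 : d⁄dX ℝ ((1 : Matrix n n ℝ⟦X⟧) i j) = 0 := by
      rw [Matrix.one_apply]; split_ifs <;> simp
    simp [hM, h1]
  rw [Derivation.map_det, hD, hadj, Matrix.smul_mul, Matrix.trace_smul, Matrix.mul_neg,
    Matrix.trace_neg, Matrix.trace_mul_comm, smul_eq_mul, mul_neg]
  congr 2
  ext k
  simp [Matrix.trace, hAP]

section Transfer

open PowerSeries

variable {V : Type*} [Fintype V] [DecidableEq V] (Adj : V → V → Prop) [DecidableRel Adj]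
  (S : V → Set ℕ)

/-- A step of the run-length automaton: in state `(r, v)`, the current run of `v` has already
`r + 1` letters; it either continues, or ends and is followed by a new run. -/
def RunStep {V : Type*} (Adj : V → V → Prop) (S : V → Set ℕ) (p q : ℕ × V) : Prop :=
  (q.1 = p.1 + 1 ∧ q.2 = p.2) ∨ (q.1 = 0 ∧ p.1 + 1 ∈ S p.2 ∧ Adj p.2 q.2)

open Classical in
/-- The transition matrix of the run-length automaton, truncated to runs of length at most `N`. -/
noncomputable def runMatrix {V : Type*} (Adj : V → V → Prop) (S : V → Set ℕ) (N : ℕ) :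
    Matrix (Fin N × V) (Fin N × V) ℝ :=
  Matrix.of fun p q => if RunStep Adj S (p.1, p.2) (q.1, q.2) then 1 else 0

open Classical in
/-- The generating function of a set of natural numbers as a formal power series. -/
noncomputable def genSeries (s : Set ℕ) : ℝ⟦X⟧ :=
  PowerSeries.mk fun n => if n ∈ s then 1 else 0

/-- The generating matrix over formal power series. -/
noncomputable def genSeriesMatrix : Matrix V V ℝ⟦X⟧ :=
  Matrix.of fun i j => if Adj i j then genSeries (S i) else 0

/-- The power series matrix of a set-equipped graph, truncated to exponents at most `N`. -/
noncomputable def truncGenMatrix (N : ℕ) : Matrix V V ℝ⟦X⟧ :=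
  genSeriesMatrix Adj fun v => {s | s ∈ S v ∧ 0 < s ∧ s ≤ N}

theorem genSeries_trunc (s : Set ℕ) [DecidablePred (· ∈ s)] (N : ℕ) :
    genSeries {n | n ∈ s ∧ 0 < n ∧ n ≤ N} =
      ∑ r : Fin N, if (r : ℕ) + 1 ∈ s then (X : ℝ⟦X⟧) ^ ((r : ℕ) + 1) else 0 := by
  classical
  ext k
  rw [genSeries, coeff_mk, map_sum]
  simp only [apply_ite (coeff (R := ℝ) k), coeff_X_pow, map_zero, Set.mem_ofPred_eq]
  split_ifs with h
  · rw [Finset.sum_eq_single (⟨k - 1, by omega⟩ : Fin N)]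
    · have : k - 1 + 1 = k := by omega
      simp [this, h.1]
    · intro b _ hb
      have : k ≠ b + 1 := fun h => hb (Fin.ext (by simp [h]))
      simp [this]
    · simp
  · refine (Finset.sum_eq_zero fun r _ => ?_).symm
    split_ifs with h1 h2
    · exact absurd ⟨h2 ▸ h1, by omega, by omega⟩ h
    · rfl
    · rfl

theorem det_one_sub_X_smul_runMatrix (hLoop : ∀ v, ¬ Adj v v) (N : ℕ) :
    (1 - (X : ℝ⟦X⟧) • (runMatrix Adj S N).map (C (R := ℝ))).det =
      (1 - truncGenMatrix Adj S N).det := by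
  classical
  let T : Matrix (Fin N) (Fin N) ℝ⟦X⟧ :=
    Matrix.of fun r r' => if (r' : ℕ) = r + 1 then 1 else 0
  let T' : Matrix (Fin N × V) (Fin N × V) ℝ⟦X⟧ :=
    Matrix.blockDiagonal fun _ : V => 1 - (X : ℝ⟦X⟧) • T
  let L : Matrix (Fin N × V) V ℝ⟦X⟧ :=
    Matrix.of fun p w => if (p.1 : ℕ) + 1 ∈ S p.2 ∧ Adj p.2 w then X else 0
  let E : Matrix V (Fin N × V) ℝ⟦X⟧ :=
    Matrix.of fun w p => if w = p.2 ∧ (p.1 : ℕ) = 0 then 1 else 0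
  let Y : Matrix V (Fin N × V) ℝ⟦X⟧ :=
    Matrix.of fun w p => if w = p.2 then X ^ (p.1 : ℕ) else 0
  have hT : (1 - (X : ℝ⟦X⟧) • T).det = 1 := by
    rw [Matrix.det_of_isUpperTriangular]
    · simp [T]
    · intro i j hij
      have h1 : i ≠ j := (ne_of_lt hij).symm
      have h2 : (j : ℕ) ≠ i + 1 := by
        have : (j : ℕ) < i := hij
        omega
      simp [T, h1, h2]
  have hT' : T'.det = 1 := by simp [T', Matrix.det_blockDiagonal, hT]
  have hYT : Y * T' = E := by
    ext1 w ⟨r', v⟩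
    rw [Matrix.mul_apply, Fintype.sum_prod_type_right]
    simp only [Y, T', E, Matrix.of_apply, Matrix.blockDiagonal_apply, ite_mul, zero_mul, mul_ite,
      mul_zero]
    rw [Finset.sum_comm]
    simp only [Finset.sum_ite_eq', Finset.mem_univ, if_true]
    by_cases hwv : w = v
    · simp only [hwv, if_true, true_and, Matrix.sub_apply, mul_sub, Finset.sum_sub_distrib,
        Matrix.smul_apply, smul_eq_mul, T, Matrix.of_apply, Matrix.one_apply, mul_ite, mul_one,
        mul_zero, Finset.sum_ite_eq', Finset.mem_univ]
      split_ifs with h0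
      · rw [Finset.sum_eq_zero]
        · simp [h0]
        · intro r _
          rw [if_neg (by omega)]
      · rw [Finset.sum_eq_single (⟨r' - 1, by omega⟩ : Fin N)]
        · have : (r' : ℕ) = r' - 1 + 1 := by omega
          rw [if_pos this, ← pow_succ, ← this, sub_self]
        · intro r _ hr
          rw [if_neg fun h => hr (Fin.ext (by simp [h]))]
        · simp
    · simp [hwv]
  have hYL : Y * L = truncGenMatrix Adj S N := by
    ext1 w u
    rw [Matrix.mul_apply, Fintype.sum_prod_type_right, Finset.sum_eq_single w]
    · simp only [Y, L, truncGenMatrix, genSeriesMatrix, genSeries_trunc, Matrix.of_apply, if_true]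
      by_cases h : Adj w u <;> simp [h, pow_succ]
    · intro v _ hv
      simp [Y, hv.symm]
    · simp
  have hLE : (X : ℝ⟦X⟧) • (runMatrix Adj S N).map (C (R := ℝ)) = (1 - T') + L * E := by
    ext1 ⟨r, v⟩ ⟨r', v'⟩
    rw [Matrix.add_apply, Matrix.mul_apply, Finset.sum_eq_single v']
    · simp only [Matrix.smul_apply, Matrix.map_apply, runMatrix, Matrix.of_apply, RunStep,
        Matrix.sub_apply, T', Matrix.blockDiagonal_apply, L, E, T, Matrix.one_apply, Prod.mk.injEq,
        smul_eq_mul, true_and]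
      by_cases h1 : v = v' <;> by_cases h2 : (r' : ℕ) = r + 1 <;> by_cases h3 : (r' : ℕ) = 0 <;>
        by_cases h4 : (r : ℕ) + 1 ∈ S v <;> by_cases h5 : Adj v v' <;>
        first
        | omega
        | exact absurd (h1 ▸ h5) (hLoop _)
        | (simp [h1, h2, h3, h4, h5, eq_comm])
    · intro w _ hw
      simp [E, hw]
    · simp
  have hfac : 1 - ((1 - T') + L * E) = (1 - L * Y) * T' := by
    rw [← hYT, Matrix.sub_mul, Matrix.one_mul, Matrix.mul_assoc]
    abel
  rw [hLE, hfac, Matrix.det_mul, hT', mul_one, Matrix.det_one_sub_mul_comm, hYL]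

/-- Truncating at exponent `N` keeps the coefficients of `det (1 - B)` up to degree `N`. -/
theorem coeff_det_one_sub_truncGenMatrix (hPos : ∀ v, 0 ∉ S v) {N k : ℕ} (hk : k ≤ N) :
    coeff k (1 - truncGenMatrix Adj S N).det = coeff k (1 - genSeriesMatrix Adj S).det := by
  let φ := Ideal.Quotient.mk (Ideal.span {(X : ℝ⟦X⟧) ^ (N + 1)})
  have h : φ (1 - truncGenMatrix Adj S N).det = φ (1 - genSeriesMatrix Adj S).det := by
    rw [RingHom.map_det, RingHom.map_det]
    congr 1
    ext1 i j
    refine Ideal.Quotient.eq.2 (Ideal.mem_span_singleton.2 (X_pow_dvd_iff.2 fun m hm => ?_))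
    simp only [truncGenMatrix, genSeriesMatrix, Matrix.sub_apply, Matrix.of_apply]
    split_ifs
    · have : 0 < m ∨ m ∉ S i := by
        rcases m.eq_zero_or_pos with rfl | h
        · exact Or.inr (hPos i)
        · exact Or.inl h
      have hm' : m ≤ N := by omega
      by_cases hS : m ∈ S i
      · simp [genSeries, hS, hm', this.resolve_right (not_not.2 hS)]
      · simp [genSeries, hS]
    · simp
  have := X_pow_dvd_iff.1 (Ideal.mem_span_singleton.1 (Ideal.Quotient.eq.1 h)) k (by omega)
  rwa [map_sub, sub_eq_zero] at this

end Transfer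

theorem apply_emod_of_periodic {A : Type*} {f : ℤ → A} {n : ℕ} (hf : ∀ m, f (m + n) = f m)
    (m : ℤ) : f (m % n) = f m := by
  rw [Int.emod_def, mul_comm]
  exact Function.Periodic.sub_int_mul_eq (f := f) (c := (n : ℤ)) hf (m / n)

section TraceCount

variable {Q : Type*} [Fintype Q] [DecidableEq Q] (R : Q → Q → Prop)

open Classical in
/-- Entries of the powers of a zero-one matrix count walks. -/
theorem pow_apply_eq_sum_walks (n : ℕ) (i j : Q) :
    ((Matrix.of fun p q : Q => if R p q then (1 : ℝ) else 0) ^ n) i j =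
      ∑ g : Fin (n + 1) → Q, if g 0 = i ∧ g (Fin.last n) = j ∧
        ∀ k : Fin n, R (g k.castSucc) (g k.succ) then 1 else 0 := by
  induction n generalizing i with
  | zero =>
    rw [← (Equiv.funUnique (Fin 1) Q).symm.sum_comp, Finset.sum_eq_single i]
    · simp [Matrix.one_apply]
    · intro b _ hb
      simp [hb]
    · simp
  | succ n ih =>
    have hcons : ∀ F : (Fin (n + 2) → Q) → ℝ,
        ∑ g, F g = ∑ a, ∑ g : Fin (n + 1) → Q, F (Fin.cons a g) := fun F => by
      rw [← (Fin.consEquiv fun _ => Q).sum_comp, Fintype.sum_prod_type]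
      rfl
    rw [pow_succ', Matrix.mul_apply, hcons]
    trans ∑ g : Fin (n + 1) → Q, if R i (g 0) ∧ g (Fin.last n) = j ∧
        ∀ k : Fin n, R (g k.castSucc) (g k.succ) then (1 : ℝ) else 0
    · simp only [ih, Finset.mul_sum]
      rw [Finset.sum_comm]
      refine Finset.sum_congr rfl fun g _ => ?_
      rw [Finset.sum_eq_single (g 0)]
      · simp only [Matrix.of_apply, true_and, ite_and, mul_ite, mul_one, mul_zero]
        split_ifs <;> rfl
      · intro b _ hb
        rw [if_neg fun h => hb h.1.symm, mul_zero]
      · simp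
    · rw [Finset.sum_eq_single i]
      · refine Finset.sum_congr rfl fun g _ => if_congr ?_ rfl rfl
        rw [Fin.forall_fin_succ (n := n)]
        simp only [Fin.cons_zero, ← Fin.succ_last, Fin.cons_succ, Fin.castSucc_zero,
          ← Fin.succ_castSucc]
        tauto
      · intro b _ hb
        exact Finset.sum_eq_zero fun g _ => if_neg fun h => hb h.1
      · simp

open Classical in
/-- Traces of the powers of a zero-one matrix count periodic bi-infinite walks. -/
theorem trace_pow_eq_ncard_periodic_walks (n : ℕ) (hn : 0 < n) :
    ((Matrix.of fun p q : Q => if R p q then (1 : ℝ) else 0) ^ n).trace =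
      {f : ℤ → Q | (∀ m, R (f m) (f (m + 1))) ∧ ∀ m, f (m + n) = f m}.ncard := by
  let W : Finset (Fin (n + 1) → Q) := {g | g (Fin.last n) = g 0 ∧
    ∀ k : Fin n, R (g k.castSucc) (g k.succ)}
  have h1 : ((Matrix.of fun p q : Q => if R p q then (1 : ℝ) else 0) ^ n).trace = W.card := by
    have := pow_apply_eq_sum_walks R n
    rw [Matrix.trace, Finset.card_filter, Nat.cast_sum]
    trans ∑ i, ∑ g : Fin (n + 1) → Q, if g 0 = i ∧ g (Fin.last n) = i ∧
        ∀ k : Fin n, R (g k.castSucc) (g k.succ) then (1 : ℝ) else 0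
    · refine Finset.sum_congr rfl fun i _ => ?_
      rw [← this, Matrix.diag_apply]
    rw [Finset.sum_comm]
    refine Finset.sum_congr rfl fun g _ => ?_
    rw [Finset.sum_eq_single (g 0)]
    · simp
    · intro b _ hb
      simp [hb.symm]
    · simp
  rw [h1, ← Set.ncard_coe_finset]
  congr 1
  symm
  refine Set.ncard_congr (fun f _ k => f (k : ℕ)) ?_ ?_ ?_
  · rintro f ⟨hf, hp⟩
    simp only [W, Finset.coe_filter, Finset.mem_univ, true_and, Set.mem_ofPred_eq]
    refine ⟨by simpa using hp 0, fun k => ?_⟩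
    simpa using hf (k : ℕ)
  · rintro f g ⟨-, hf⟩ ⟨-, hg⟩ h
    funext m
    have h0 := Int.emod_nonneg m (b := n) (by omega)
    have h2 := Int.emod_lt_of_pos m (b := n) (by omega)
    have := congrFun h ⟨(m % n).toNat, by omega⟩
    rw [← apply_emod_of_periodic hf, ← apply_emod_of_periodic hg]
    simpa [Int.toNat_of_nonneg h0] using this
  · intro g hg
    simp only [W, Finset.coe_filter, Finset.mem_univ, true_and, Set.mem_ofPred_eq] at hg
    have hb : ∀ m : ℤ, (m % n).toNat < n := fun m => by
      have h2 := Int.emod_lt_of_pos m (b := n) (by omega)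
      omega
    refine ⟨fun m => g ⟨(m % n).toNat, (hb m).trans (Nat.lt_succ_self n)⟩,
      ⟨fun m => ?_, fun m => by simp⟩, ?_⟩
    · have h0 := Int.emod_nonneg m (b := n) (by omega)
      have h2 := Int.emod_lt_of_pos m (b := n) (by omega)
      have hsucc : g ⟨((m + 1) % n).toNat, (hb (m + 1)).trans (Nat.lt_succ_self n)⟩ =
          g (Fin.succ ⟨(m % n).toNat, hb m⟩) := by
        have hm := Int.emod_add_emod m n 1
        rcases (show m % n + 1 < n ∨ m % n + 1 = n by omega) with h | h
        · rw [Int.emod_eq_of_lt (by omega) h] at hm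
          congr 1
          ext
          simp only [Fin.val_succ]
          omega
        · rw [h, Int.emod_self] at hm
          have e2 : (⟨(m % n).toNat, hb m⟩ : Fin n).succ = Fin.last n := by
            ext
            simp only [Fin.val_succ, Fin.val_last]
            omega
          rw [e2, hg.1]
          congr 1
          ext
          simp [← hm]
      dsimp only
      rw [hsucc]
      exact hg.2 ⟨(m % n).toNat, hb m⟩
    · funext k
      dsimp only
      rcases (show (k : ℕ) < n ∨ (k : ℕ) = n by omega) with h | h
      · congr 1
        ext
        simp [Int.emod_eq_of_lt (show (0 : ℤ) ≤ k by omega) (show (k : ℤ) < n by omega)]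
      · have : k = Fin.last n := Fin.ext h
        subst this
        rw [hg.1]
        congr 1
        ext; simp

end TraceCount

section Dynamics

variable {V : Type*} {Adj : V → V → Prop} {S : V → Set ℕ}

/-- Every finite maximal run of `x` has an admissible length and is followed by a neighbour. -/
def IsLocallyAdmissible (Adj : V → V → Prop) (S : V → Set ℕ) (x : ℤ → V) : Prop :=
  ∀ p q : ℤ, p < q → x (p - 1) ≠ x p → (∀ k, p ≤ k → k < q → x k = x p) → x q ≠ x p →
    Adj (x p) (x q) ∧ (q - p).toNat ∈ S (x p)

theorem exists_runStep_of_mem_core {x : ℤ → V} (hx : x ∈ SGraphCore Adj S) :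
    ∃ f : ℤ → ℕ × V, (∀ m, RunStep Adj S (f m) (f (m + 1))) ∧ ∀ m, (f m).2 = x m := by
  obtain ⟨a, t, ht, hS, hA, hxa, hcov⟩ := hx
  choose i hi using hcov
  have huniq : ∀ m j, t j ≤ m → m < t (j + 1) → i m = j := by
    intro m j h1 h2
    have h3 := ht.lt_iff_lt.1 ((hi m).1.trans_lt h2)
    have h4 := ht.lt_iff_lt.1 (h1.trans_lt (hi m).2)
    omega
  refine ⟨fun m => ((m - t (i m)).toNat, x m), fun m => ?_, fun m => rfl⟩
  obtain ⟨h1, h2⟩ := hi m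
  have hxm := hxa _ m h1 h2
  rcases (Int.add_one_le_of_lt h2).lt_or_eq with h | h
  · left
    have h3 := huniq (m + 1) (i m) (by omega) h
    refine ⟨?_, ?_⟩
    · simp only [h3]; omega
    · simp only [hxm, hxa (i m) (m + 1) (by omega) h]
  · right
    have h4 := ht (show i m + 1 < i m + 1 + 1 by omega)
    have h3 := huniq (m + 1) (i m + 1) h.ge (by omega)
    refine ⟨?_, ?_, ?_⟩
    · simp only [h3]; omega
    · have := hS (i m)
      simp only [hxm]
      convert this using 1
      omega
    · simp only [hxm, hxa (i m + 1) (m + 1) h.ge (by omega)]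
      exact hA _

theorem runStep_walk_ext (hLoop : ∀ v, ¬ Adj v v) {f g : ℤ → ℕ × V}
    (hf : ∀ m, RunStep Adj S (f m) (f (m + 1))) (hg : ∀ m, RunStep Adj S (g m) (g (m + 1)))
    (h : ∀ m, (f m).2 = (g m).2) : f = g := by
  have key : ∀ (r : ℕ) (m : ℤ), (f m).1 = r → (g m).1 = r := by
    intro r
    induction r with
    | zero =>
      intro m hm
      have h1 := hf (m - 1)
      have h2 := hg (m - 1)
      rw [sub_add_cancel] at h1 h2
      rcases h1 with h1 | h1
      · omega
      · rcases h2 with h2 | h2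
        · rw [← h, ← h] at h2
          exact absurd (h2.2 ▸ h1.2.2) (hLoop _)
        · exact h2.1
    | succ r ih =>
      intro m hm
      have h1 := hf (m - 1)
      have h2 := hg (m - 1)
      rw [sub_add_cancel] at h1 h2
      rcases h1 with h1 | h1
      · have h3 := ih (m - 1) (by omega)
        rcases h2 with h2 | h2
        · omega
        · rw [← h, ← h] at h2
          exact absurd (h1.2 ▸ h2.2.2) (hLoop _)
      · omega
  funext m
  exact Prod.ext (key _ m rfl).symm (h m)

theorem isLocallyAdmissible_of_walk (hLoop : ∀ v, ¬ Adj v v) {f : ℤ → ℕ × V}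
    (hf : ∀ m, RunStep Adj S (f m) (f (m + 1))) :
    IsLocallyAdmissible Adj S fun m => (f m).2 := by
  intro p q hpq hp hconst hq
  have age : ∀ k : ℕ, p + k < q → (f (p + k)).1 = k := by
    intro k
    induction k with
    | zero =>
      intro _
      have h1 := hf (p - 1)
      rw [sub_add_cancel] at h1
      rcases h1 with h1 | h1
      · exact absurd h1.2.symm hp
      · simpa using h1.1
    | succ k ih =>
      intro hk
      push_cast at hk ⊢
      have h1 := hf (p + k)
      rw [add_assoc] at h1
      rcases h1 with h1 | h1
      · rw [h1.1, ih (by omega)]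
      · have h2 := h1.2.2
        have e1 := hconst (p + k) (by omega) (by omega)
        have e2 := hconst (p + (k + 1)) (by omega) (by omega)
        dsimp only at e1 e2
        rw [e1, e2] at h2
        exact absurd h2 (hLoop _)
  have h1 := hf (q - 1)
  have e1 := hconst (q - 1) (by omega) (by omega)
  have e2 := age (q - p - 1).toNat (by omega)
  have e3 : p + ((q - p - 1).toNat : ℤ) = q - 1 := by omega
  rw [e3] at e2
  dsimp only at e1 hq ⊢
  rw [sub_add_cancel, RunStep, e1, e2] at h1
  rcases h1 with h1 | h1
  · exact absurd h1.2 hq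
  · refine ⟨h1.2.2, ?_⟩
    convert h1.2.1 using 1
    omega

theorem mem_core_of_isLocallyAdmissible {x : ℤ → V} (hx : IsLocallyAdmissible Adj S x)
    (hup : ∀ m, ∃ p > m, x (p - 1) ≠ x p) (hdown : ∀ m, ∃ p < m, x (p - 1) ≠ x p) :
    x ∈ SGraphCore Adj S := by
  classical
  let ι := {p : ℤ // x (p - 1) ≠ x p}
  have : Nonempty ι := let ⟨p, _, hp⟩ := hup 0; ⟨⟨p, hp⟩⟩
  have : NoMaxOrder ι := ⟨fun a => let ⟨p, h, hp⟩ := hup a.1; ⟨⟨p, hp⟩, h⟩⟩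
  have : NoMinOrder ι := ⟨fun a => let ⟨p, h, hp⟩ := hdown a.1; ⟨⟨p, hp⟩, h⟩⟩
  have : LocallyFiniteOrder ι := inferInstanceAs (LocallyFiniteOrder (Subtype _))
  let : SuccOrder ι := LinearLocallyFiniteOrder.succOrder ι
  let : PredOrder ι := LinearLocallyFiniteOrder.predOrder ι
  let e : ι ≃o ℤ := orderIsoIntOfLinearSuccPredArch
  let t : ℤ → ℤ := fun i => (e.symm i).1
  have ht : StrictMono t := fun i j h => e.symm.strictMono h
  have hb : ∀ i, x (t i - 1) ≠ x (t i) := fun i => (e.symm i).2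
  have hgap : ∀ i k, t i < k → k < t (i + 1) → x (k - 1) = x k := by
    intro i k h1 h2
    by_contra h
    have h3 : i < e ⟨k, h⟩ := by
      rw [← e.symm.lt_iff_lt, e.symm_apply_apply]; exact h1
    have h4 : e ⟨k, h⟩ < i + 1 := by
      rw [← e.symm.lt_iff_lt, e.symm_apply_apply]; exact h2
    omega
  have hconst : ∀ i k, t i ≤ k → k < t (i + 1) → x k = x (t i) := by
    intro i k h1
    induction k, h1 using Int.leInduction with
    | base => intro _; rfl
    | succ k hk ih =>
      intro h2
      rw [← ih (by omega), ← hgap i (k + 1) (by omega) h2, add_sub_cancel_right]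
  have hadm : ∀ i, Adj (x (t i)) (x (t (i + 1))) ∧ (t (i + 1) - t i).toNat ∈ S (x (t i)) := by
    intro i
    have h1 := ht (show i < i + 1 by omega)
    refine hx _ _ h1 (hb i) (hconst i) fun h => hb (i + 1) ?_
    rw [h, hconst i (t (i + 1) - 1) (by omega) (by omega)]
  refine ⟨fun i => x (t i), t, ht, fun i => (hadm i).2, fun i => (hadm i).1, hconst, fun m => ?_⟩
  have hbound : ∀ k : ℕ, t 0 + k ≤ t k ∧ t (-k) ≤ t 0 - k := by
    intro k
    induction k with
    | zero => simp
    | succ k ih =>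
      have h1 := ht (show (k : ℤ) < (k + 1 : ℕ) by push_cast; omega)
      have h2 := ht (show (-(k + 1 : ℕ) : ℤ) < -k by push_cast; omega)
      push_cast at *
      omega
  have hlow : ∃ i, t i ≤ m := ⟨-((t 0 - m).toNat : ℤ), by
    have := (hbound (t 0 - m).toNat).2
    omega⟩
  have hhigh : ∀ i, t i ≤ m → i ≤ (m - t 0).toNat := by
    intro i hi
    by_contra! h
    have h1 := (hbound (m - t 0).toNat).1
    have h2 := ht h
    omega
  obtain ⟨i, hi, hmax⟩ := Int.exists_greatest_of_bdd ⟨_, hhigh⟩ hlow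
  refine ⟨i, hi, ?_⟩
  by_contra! h
  have := hmax _ h
  omega

theorem exists_boundary_of_not_constant {x : ℤ → V} (hx : shiftMap x ≠ x) :
    ∃ p, x (p - 1) ≠ x p := by
  by_contra! h
  exact hx (funext fun i => by simpa [shiftMap] using (h (i + 1)).symm)

theorem mem_core_of_periodic {x : ℤ → V} (hx : IsLocallyAdmissible Adj S x) {n : ℕ} (hn : 0 < n)
    (hper : ∀ m, x (m + n) = x m) (hne : shiftMap x ≠ x) : x ∈ SGraphCore Adj S := by
  obtain ⟨p, hp⟩ := exists_boundary_of_not_constant hne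
  have hmul : ∀ (k : ℤ) (m : ℤ), x (m + k * n) = x m := fun k m =>
    (Function.Periodic.int_mul (f := x) (c := (n : ℤ)) hper k) m
  have hbd : ∀ k : ℤ, x (p + k * n - 1) ≠ x (p + k * n) := fun k => by
    rw [add_sub_right_comm, hmul, hmul]; exact hp
  refine mem_core_of_isLocallyAdmissible hx (fun m => ⟨p + (|m - p| + 1) * n, ?_, hbd _⟩)
    (fun m => ⟨p + (-(|m - p| + 1)) * n, ?_, hbd _⟩)
  · have := le_abs_self (m - p)
    have : (1 : ℤ) ≤ n := by omega
    nlinarith [abs_nonneg (m - p)]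
  · have := neg_abs_le (m - p)
    have : (1 : ℤ) ≤ n := by omega
    nlinarith [abs_nonneg (m - p)]

theorem isLocallyAdmissible_of_mem_closure [TopologicalSpace V] [DiscreteTopology V]
    (hLoop : ∀ v, ¬ Adj v v) {x : ℤ → V} (hx : x ∈ closure (SGraphCore Adj S)) :
    IsLocallyAdmissible Adj S x := by
  intro p q hpq hp hconst hq
  have hopen : IsOpen (Set.pi (Set.Icc (p - 1) q) fun i => ({x i} : Set V)) :=
    isOpen_set_pi (Set.finite_Icc _ _) fun i _ => isOpen_discrete _
  obtain ⟨y, hyU, hy⟩ := mem_closure_iff.1 hx _ hopen fun i _ => rfl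
  have hyx : ∀ i, p - 1 ≤ i → i ≤ q → y i = x i := fun i h1 h2 => hyU i ⟨h1, h2⟩
  obtain ⟨f, hf, hfy⟩ := exists_runStep_of_mem_core hy
  have := isLocallyAdmissible_of_walk hLoop hf p q hpq
  simp only [hfy, hyx p (by omega) hpq.le, hyx q (by omega) le_rfl,
    hyx (p - 1) le_rfl (by omega)] at this
  exact this hp (fun k h1 h2 => by rw [hyx k (by omega) h2.le, hconst k h1 h2]) hq

theorem shiftMap_ne_of_mem_core (hLoop : ∀ v, ¬ Adj v v) {x : ℤ → V}
    (hx : x ∈ SGraphCore Adj S) : shiftMap x ≠ x := by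
  obtain ⟨a, t, ht, -, hA, hxa, -⟩ := hx
  intro h
  have h01 := ht (show (0 : ℤ) < 0 + 1 by omega)
  have h12 := ht (show (0 + 1 : ℤ) < 0 + 1 + 1 by omega)
  have h1 := congrFun h (t (0 + 1) - 1)
  rw [shiftMap, sub_add_cancel, hxa 0 (t (0 + 1) - 1) (by omega) (by omega),
    hxa (0 + 1) (t (0 + 1)) le_rfl (by omega)] at h1
  exact hLoop _ (h1 ▸ hA 0)

theorem shiftMap_iterate_apply (n : ℕ) (x : ℤ → V) (m : ℤ) : shiftMap^[n] x m = x (m + n) := by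
  induction n generalizing x with
  | zero => simp
  | succ n ih =>
    rw [Function.iterate_succ_apply, ih, shiftMap]
    push_cast
    congr 1
    ring

theorem shiftMap_iterate_eq_iff (n : ℕ) (x : ℤ → V) :
    shiftMap^[n] x = x ↔ ∀ m, x (m + n) = x m := by
  simp only [funext_iff, shiftMap_iterate_apply]

theorem runStep_sub {f : ℤ → ℕ × V} (hf : ∀ m, RunStep Adj S (f m) (f (m + 1))) (m : ℤ) (k : ℕ)
    (hk : k ≤ (f m).1) : (f (m - k)).1 = (f m).1 - k := by
  induction k with
  | zero => simp
  | succ k ih =>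
    have h1 := ih (by omega)
    have h2 := hf (m - (k + 1 : ℕ))
    rw [show m - ((k + 1 : ℕ) : ℤ) + 1 = m - k by push_cast; ring] at h2
    rcases h2 with h2 | h2 <;> omega

theorem age_lt_of_periodic {f : ℤ → ℕ × V} (hf : ∀ m, RunStep Adj S (f m) (f (m + 1))) {n : ℕ}
    (hn : 0 < n) (hper : ∀ m, f (m + n) = f m) (m : ℤ) : (f m).1 < n := by
  by_contra! h
  have h1 := runStep_sub hf m n h
  rw [← hper, sub_add_cancel] at h1
  omega

theorem shiftMap_ne_of_periodic_walk (hLoop : ∀ v, ¬ Adj v v) {f : ℤ → ℕ × V}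
    (hf : ∀ m, RunStep Adj S (f m) (f (m + 1))) {n : ℕ} (hn : 0 < n)
    (hper : ∀ m, f (m + n) = f m) : shiftMap (fun m => (f m).2) ≠ fun m => (f m).2 := by
  intro h
  have hstep : ∀ m, (f (m + 1)).1 = (f m).1 + 1 := by
    intro m
    rcases hf m with h1 | h1
    · exact h1.1
    · have h2 : (f (m + 1)).2 = (f m).2 := congrFun h m
      exact absurd (h2 ▸ h1.2.2) (hLoop _)
  have hk : ∀ k : ℕ, (f k).1 = (f 0).1 + k := by
    intro k
    induction k with
    | zero => simp
    | succ k ih => push_cast; rw [hstep, ih, add_assoc]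
  have h1 := hk n
  have h2 := hper 0
  rw [zero_add] at h2
  rw [h2] at h1
  omega

/-- Periodic points of the core correspond to periodic walks of the run-length automaton. -/
theorem ncard_periodic_core (hLoop : ∀ v, ¬ Adj v v) {n : ℕ} (hn : 0 < n) :
    {x ∈ SGraphCore Adj S | shiftMap^[n] x = x}.ncard =
      {f : ℤ → ℕ × V | (∀ m, RunStep Adj S (f m) (f (m + 1))) ∧ ∀ m, f (m + n) = f m}.ncard := by
  symm
  refine Set.ncard_congr (fun f _ m => (f m).2) ?_ ?_ ?_
  · rintro f ⟨hf, hper⟩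
    have hper' : ∀ m, (f (m + n)).2 = (f m).2 := fun m => by rw [hper]
    exact ⟨mem_core_of_periodic (isLocallyAdmissible_of_walk hLoop hf) hn hper'
      (shiftMap_ne_of_periodic_walk hLoop hf hn hper), (shiftMap_iterate_eq_iff _ _).2 hper'⟩
  · rintro f g ⟨hf, -⟩ ⟨hg, -⟩ h
    exact runStep_walk_ext hLoop hf hg fun m => congrFun h m
  · rintro x ⟨hx, hper⟩
    rw [shiftMap_iterate_eq_iff] at hper
    obtain ⟨f, hf, hfx⟩ := exists_runStep_of_mem_core hx
    refine ⟨f, ⟨hf, fun m => ?_⟩, funext hfx⟩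
    have : (fun m => f (m + n)) = f := runStep_walk_ext hLoop
      (fun m => by simpa only [add_right_comm] using hf (m + n)) hf
      fun m => by rw [hfx, hfx, hper]
    exact congrFun this m

theorem ncard_periodic_walk_truncate {n N : ℕ} (hn : 0 < n) (hN : n ≤ N) :
    {f : ℤ → ℕ × V | (∀ m, RunStep Adj S (f m) (f (m + 1))) ∧ ∀ m, f (m + n) = f m}.ncard =
      {f : ℤ → Fin N × V | (∀ m, RunStep Adj S ((f m).1, (f m).2) ((f (m + 1)).1, (f (m + 1)).2)) ∧
        ∀ m, f (m + n) = f m}.ncard := by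
  symm
  refine Set.ncard_congr (fun f _ m => (((f m).1 : ℕ), (f m).2)) ?_ ?_ ?_
  · rintro f ⟨hf, hper⟩
    exact ⟨hf, fun m => by simp only [hper]⟩
  · rintro f g - - h
    funext m
    have := congrFun h m
    simp only [Prod.mk.injEq] at this
    exact Prod.ext (Fin.ext this.1) this.2
  · rintro f ⟨hf, hper⟩
    have hlt := age_lt_of_periodic hf hn hper
    refine ⟨fun m => (⟨(f m).1, (hlt m).trans_le hN⟩, (f m).2), ⟨hf, fun m => ?_⟩, rfl⟩
    simp only [hper]

theorem injOn_restrict_periodic (n : ℕ) (hn : 0 < n) :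
    Set.InjOn (fun (x : ℤ → V) (k : Fin n) => x (k : ℕ)) {x | shiftMap^[n] x = x} := by
  intro x hx y hy h
  funext m
  have h0 := Int.emod_nonneg m (b := n) (by omega)
  have h2 := Int.emod_lt_of_pos m (b := n) (by omega)
  have := congrFun h ⟨(m % n).toNat, by omega⟩
  rw [← apply_emod_of_periodic ((shiftMap_iterate_eq_iff _ _).1 hx),
    ← apply_emod_of_periodic ((shiftMap_iterate_eq_iff _ _).1 hy)]
  simpa [Int.toNat_of_nonneg h0] using this

theorem finite_periodic [Finite V] (n : ℕ) (hn : 0 < n) :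
    {x : ℤ → V | shiftMap^[n] x = x}.Finite :=
  Set.Finite.of_injOn (Set.mapsTo_univ _ _) (injOn_restrict_periodic n hn) Set.finite_univ

theorem ncard_periodic_le [Fintype V] (X : Set (ℤ → V)) (n : ℕ) (hn : 0 < n) :
    perCount X n ≤ Fintype.card V ^ n := by
  have h1 := Set.ncard_le_ncard_of_injOn (t := Set.univ) _ (fun _ _ => Set.mem_univ _)
    ((injOn_restrict_periodic (V := V) n hn).mono (fun x hx => hx.2 :
      {x ∈ X | shiftMap^[n] x = x} ⊆ _)) Set.finite_univ
  rw [Set.ncard_univ, Nat.card_eq_fintype_card, Fintype.card_fun, Fintype.card_fin] at h1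
  exact h1

/-- Periodic points of an `S`-graph shift are fixed points or lie in the core. -/
theorem perCount_closure_core [Finite V] [TopologicalSpace V] [DiscreteTopology V]
    (hLoop : ∀ v, ¬ Adj v v) {n : ℕ} (hn : 0 < n) :
    perCount (closure (SGraphCore Adj S)) n =
      perCount (closure (SGraphCore Adj S)) 1 + perCount (SGraphCore Adj S) n := by
  unfold perCount
  rw [← Set.ncard_union_eq ?_ ((finite_periodic 1 one_pos).subset fun x hx => hx.2)
    ((finite_periodic n hn).subset fun x hx => hx.2)]
  · congr 1
    ext x
    simp only [Set.mem_union, Set.mem_ofPred_eq, Function.iterate_one]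
    constructor
    · rintro ⟨hx, hper⟩
      by_cases h : shiftMap x = x
      · exact Or.inl ⟨hx, h⟩
      · exact Or.inr ⟨mem_core_of_periodic (isLocallyAdmissible_of_mem_closure hLoop hx) hn
          ((shiftMap_iterate_eq_iff _ _).1 hper) h, hper⟩
    · rintro (⟨hx, h⟩ | ⟨hx, h⟩)
      · exact ⟨hx, Function.iterate_fixed h n⟩
      · exact ⟨subset_closure hx, h⟩
  · rw [Set.disjoint_left]
    rintro x ⟨-, h⟩ ⟨hx, -⟩
    exact shiftMap_ne_of_mem_core hLoop hx h

end Dynamics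

namespace PowerSeries

/-- The subring of real power series that converge absolutely at `t`. -/
def absConvergent (t : ℝ) : Subring ℝ⟦X⟧ where
  carrier := {f | Summable fun n => ‖coeff n f * t ^ n‖}
  zero_mem' := by simp
  one_mem' := summable_of_ne_finset_zero (s := {0}) fun n hn => by
    simp [coeff_one, Finset.mem_singleton.not.1 hn]
  add_mem' {f g} hf hg := by
    refine Summable.of_nonneg_of_le (fun _ => norm_nonneg _) (fun n => ?_) (hf.add hg)
    rw [map_add, add_mul]
    exact norm_add_le _ _
  neg_mem' {f} hf := by simpa using hf
  mul_mem' {f g} hf hg := by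
    refine (summable_norm_sum_mul_antidiagonal_of_summable_norm hf hg).congr fun n => ?_
    rw [coeff_mul, Finset.sum_mul]
    congr 1
    refine Finset.sum_congr rfl fun p hp => ?_
    rw [← Finset.HasAntidiagonal.mem_antidiagonal.1 hp, pow_add]
    ring

/-- The value of a real power series at a point. -/
noncomputable def evalReal (f : ℝ⟦X⟧) (t : ℝ) : ℝ := ∑' n, coeff n f * t ^ n

/-- Evaluation as a ring homomorphism on the absolutely convergent power series. -/
noncomputable def evalHom (t : ℝ) : absConvergent t →+* ℝ where
  toFun f := evalReal f t
  map_zero' := by simp [evalReal]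
  map_one' := by
    rw [evalReal, tsum_eq_single 0] <;> simp +contextual [coeff_one]
  map_add' f g := by
    have hf : Summable _ := Summable.of_norm f.2
    have hg : Summable _ := Summable.of_norm g.2
    simp only [evalReal, Subring.coe_add, map_add, add_mul]
    exact hf.tsum_add hg
  map_mul' f g := by
    rw [evalReal, evalReal, evalReal,
      tsum_mul_tsum_eq_tsum_sum_antidiagonal_of_summable_norm f.2 g.2]
    refine tsum_congr fun n => ?_
    rw [Subring.coe_mul, coeff_mul, Finset.sum_mul]
    refine Finset.sum_congr rfl fun p hp => ?_
    rw [← Finset.HasAntidiagonal.mem_antidiagonal.1 hp, pow_add]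
    ring

theorem absConvergent_mono {s t : ℝ} (h : |s| ≤ |t|) : absConvergent t ≤ absConvergent s := by
  intro f hf
  refine Summable.of_nonneg_of_le (fun _ => norm_nonneg _) (fun n => ?_) hf
  rw [norm_mul, norm_mul, norm_pow, norm_pow]
  exact mul_le_mul_of_nonneg_left (pow_le_pow_left₀ (abs_nonneg s) h n) (norm_nonneg _)

theorem mem_absConvergent_of_abs_coeff_le {f : ℝ⟦X⟧} {K M t : ℝ}
    (hf : ∀ n, |coeff n f| ≤ M * K ^ n) (hK : 0 ≤ K) (ht : K * |t| < 1) :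
    f ∈ absConvergent t := by
  have := (summable_geometric_of_lt_one (mul_nonneg hK (abs_nonneg t)) ht).mul_left M
  refine Summable.of_nonneg_of_le (fun _ => norm_nonneg _) (fun n => ?_) this
  rw [norm_mul, norm_pow, mul_pow, ← mul_assoc]
  exact mul_le_mul_of_nonneg_right (hf n) (pow_nonneg (abs_nonneg t) n)

/-- Termwise differentiation inside the disc of absolute convergence. -/
theorem hasDerivAt_evalReal {f : ℝ⟦X⟧} {ρ t : ℝ} (hf : f ∈ absConvergent ρ) (ht : |t| < ρ) :
    HasDerivAt (evalReal f) (evalReal (derivative ℝ f) t) t := by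
  obtain ⟨r, htr, hrρ⟩ := exists_between ht
  have hr : 0 < r := (abs_nonneg t).trans_lt htr
  have hρ : 0 < ρ := hr.trans hrρ
  obtain ⟨M, hM⟩ := (tendsto_self_mul_const_pow_of_lt_one (div_nonneg hr.le hρ.le)
    ((div_lt_one hρ).2 hrρ)).bddAbove_range
  have hu : Summable fun n : ℕ => ‖coeff n f‖ * (n * r ^ (n - 1)) := by
    refine Summable.of_nonneg_of_le (fun n => by positivity) (fun n => ?_) (hf.mul_left (M / r))
    have h1 : (n : ℝ) * (r / ρ) ^ n ≤ M := hM ⟨n, rfl⟩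
    rw [div_pow, mul_div_assoc', div_le_iff₀ (pow_pos hρ n)] at h1
    have h2 : (n : ℝ) * r ^ (n - 1) = n * r ^ n / r := by
      cases n with
      | zero => simp
      | succ n => rw [Nat.add_sub_cancel, pow_succ]; field_simp
    rw [norm_mul, norm_pow, Real.norm_of_nonneg hρ.le, h2]
    calc ‖coeff n f‖ * (n * r ^ n / r) ≤ ‖coeff n f‖ * (M * ρ ^ n / r) := by gcongr
      _ = M / r * (‖coeff n f‖ * ρ ^ n) := by ring
  have hbound : ∀ (n : ℕ) (y : ℝ), |y| ≤ r →
      ‖coeff n f * (n * y ^ (n - 1))‖ ≤ ‖coeff n f‖ * (n * r ^ (n - 1)) := by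
    intro n y hy
    rw [norm_mul, norm_mul, norm_pow, Real.norm_natCast, Real.norm_eq_abs y]
    gcongr
  have key := hasDerivAt_tsum_of_isPreconnected (y₀ := 0) (y := t) hu Metric.isOpen_ball
    (convex_ball (0 : ℝ) r).isPreconnected
    (g := fun n y => coeff n f * y ^ n) (g' := fun n y => coeff n f * (n * y ^ (n - 1)))
    (fun n y _ => (hasDerivAt_pow n y).const_mul _)
    (fun n y hy => hbound n y (by simpa using (mem_ball_zero_iff.1 hy).le))
    (Metric.mem_ball_self hr)
    (summable_of_ne_finset_zero (s := {0}) fun n hn => by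
      simp [Finset.mem_singleton.not.1 hn])
    (by simpa using htr)
  have hs : Summable fun n : ℕ => coeff n f * (n * t ^ (n - 1)) :=
    Summable.of_norm_bounded hu fun n => hbound n t htr.le
  have hval : evalReal (derivative ℝ f) t = ∑' n : ℕ, coeff n f * (n * t ^ (n - 1)) := by
    rw [hs.tsum_eq_zero_add, evalReal]
    simp [coeff_derivative, mul_assoc]
  rw [hval]
  exact key

/-- A power series with logarithmic derivative `-q` evaluates to `exp` of minus a primitive. -/
theorem evalReal_mul_exp_eq_one {f q l : ℝ⟦X⟧} {ρ : ℝ} (hf : f ∈ absConvergent ρ)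
    (hq : q ∈ absConvergent ρ) (hl : l ∈ absConvergent ρ) (hfq : derivative ℝ f = -(f * q))
    (hlq : derivative ℝ l = q) (hf0 : coeff 0 f = 1) (hl0 : coeff 0 l = 0) {t : ℝ}
    (ht : |t| < ρ) : evalReal f t * Real.exp (evalReal l t) = 1 := by
  have hρ : 0 < ρ := (abs_nonneg t).trans_lt ht
  have hderiv : ∀ s, |s| < ρ →
      HasDerivAt (fun s => evalReal f s * Real.exp (evalReal l s)) 0 s := by
    intro s hs
    have hle : |s| ≤ |ρ| := hs.le.trans (le_abs_self ρ)
    have hmul : evalReal (-(f * q)) s = -(evalReal f s * evalReal q s) := by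
      let f' : absConvergent s := ⟨f, absConvergent_mono hle hf⟩
      let q' : absConvergent s := ⟨q, absConvergent_mono hle hq⟩
      have h1 : evalHom s (-(f' * q')) = -(evalHom s f' * evalHom s q') := by
        rw [map_neg, map_mul]
      exact h1
    have h1 := hasDerivAt_evalReal hf hs
    have h2 := (hasDerivAt_evalReal hl hs).exp
    rw [hfq, hmul] at h1
    rw [hlq] at h2
    exact (h1.mul h2).congr_deriv (by ring)
  have hconst := (convex_ball (0 : ℝ) ρ).is_const_of_fderivWithin_eq_zero (𝕜 := ℝ)
    (f := fun s => evalReal f s * Real.exp (evalReal l s)) (x := t) (y := 0)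
    (fun s hs => (hderiv s (by simpa using hs)).differentiableAt.differentiableWithinAt)
    (fun s hs => by
      rw [fderivWithin_of_isOpen Metric.isOpen_ball hs]
      ext
      simpa using (hderiv s (by simpa using hs)).deriv)
    (by simpa using ht) (Metric.mem_ball_self hρ)
  have h0 : ∀ g : ℝ⟦X⟧, evalReal g 0 = coeff 0 g := fun g => by
    rw [evalReal, tsum_eq_single 0] <;> simp +contextual
  simp only [h0, hf0, hl0, Real.exp_zero, mul_one] at hconst
  exact hconst

end PowerSeries

section Zeta

open PowerSeries

variable {V : Type*} [Fintype V] [DecidableEq V] {Adj : V → V → Prop} {S : V → Set ℕ}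

theorem trace_runMatrix_pow (hLoop : ∀ v, ¬ Adj v v) {n N : ℕ} (hn : 0 < n) (hN : n ≤ N) :
    (runMatrix Adj S N ^ n).trace = perCount (SGraphCore Adj S) n := by
  rw [perCount, ncard_periodic_core hLoop hn, ncard_periodic_walk_truncate hn hN]
  exact trace_pow_eq_ncard_periodic_walks
    (fun p q : Fin N × V => RunStep Adj S (p.1, p.2) (q.1, q.2)) n hn

variable [DecidableRel Adj]

theorem derivative_det_one_sub_genSeriesMatrix (hLoop : ∀ v, ¬ Adj v v) (hPos : ∀ v, 0 ∉ S v) :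
    d⁄dX ℝ (1 - genSeriesMatrix Adj S).det = -((1 - genSeriesMatrix Adj S).det *
      PowerSeries.mk fun n => (perCount (SGraphCore Adj S) (n + 1) : ℝ)) := by
  ext n
  have h := congrArg (coeff n) (Matrix.derivative_det_one_sub_X_smul (runMatrix Adj S (n + 1)))
  rw [det_one_sub_X_smul_runMatrix Adj S hLoop, coeff_derivative,
    coeff_det_one_sub_truncGenMatrix Adj S hPos le_rfl] at h
  rw [coeff_derivative, h, map_neg, map_neg, coeff_mul, coeff_mul]
  congr 1
  refine Finset.sum_congr rfl fun p hp => ?_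
  have hp' := Finset.HasAntidiagonal.mem_antidiagonal.1 hp
  rw [coeff_det_one_sub_truncGenMatrix Adj S hPos (by omega), coeff_mk, coeff_mk,
    trace_runMatrix_pow hLoop (Nat.succ_pos _) (by omega)]

theorem coeff_zero_det_one_sub_genSeriesMatrix (hPos : ∀ v, 0 ∉ S v) :
    coeff 0 (1 - genSeriesMatrix Adj S).det = 1 := by
  rw [coeff_zero_eq_constantCoeff_apply, RingHom.map_det]
  convert Matrix.det_one (n := V) (R := ℝ) using 2
  ext i j
  simp only [genSeriesMatrix, RingHom.mapMatrix_apply, Matrix.map_apply, Matrix.sub_apply,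
    Matrix.of_apply, map_sub, Matrix.one_apply]
  have h : constantCoeff (genSeries (S i)) = 0 := by
    rw [← coeff_zero_eq_constantCoeff_apply, genSeries, coeff_mk, if_neg (hPos i)]
  split_ifs <;> simp [h]

theorem genSeries_mem_absConvergent (s : Set ℕ) {t : ℝ} (ht : |t| < 1) :
    genSeries s ∈ absConvergent t := by
  refine mem_absConvergent_of_abs_coeff_le (K := 1) (M := 1) (fun n => ?_) zero_le_one
    (by simpa using ht)
  rw [genSeries, coeff_mk]
  split_ifs <;> simp

theorem evalReal_genSeries {ι : Type*} (S : ι → Set ℕ) (i : ι) (t : ℝ) :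
    evalReal (genSeries (S i)) t = genFun S i t := by
  rw [genFun, tsum_subtype (S i) fun n => t ^ n, evalReal]
  refine tsum_congr fun n => ?_
  by_cases h : n ∈ S i <;> simp [genSeries, h]

theorem evalReal_det_one_sub_genSeriesMatrix {t : ℝ} (ht : |t| < 1) :
    (1 - genSeriesMatrix Adj S).det ∈ absConvergent t ∧
      evalReal (1 - genSeriesMatrix Adj S).det t = (1 - genMatrix Adj S t).det := by
  let B : Matrix V V (absConvergent t) := Matrix.of fun i j =>
    if Adj i j then ⟨genSeries (S i), genSeries_mem_absConvergent (S i) ht⟩ else 0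
  have hB : (1 - genSeriesMatrix Adj S).det = ((1 - B).det : absConvergent t) := by
    rw [← Subring.subtype_apply, RingHom.map_det, map_sub, map_one]
    congr 2
    ext1 i j
    by_cases h : Adj i j <;> simp [B, genSeriesMatrix, h]
  refine ⟨hB ▸ (1 - B).det.2, ?_⟩
  have h : evalReal (1 - genSeriesMatrix Adj S).det t = evalHom t (1 - B).det := by
    rw [hB]
    rfl
  rw [h, RingHom.map_det, map_sub, map_one]
  congr 2
  ext1 i j
  by_cases h : Adj i j
  · simp only [RingHom.mapMatrix_apply, Matrix.map_apply, B, Matrix.of_apply, genMatrix, if_pos h]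
    exact evalReal_genSeries S i t
  · simp [B, genMatrix, h]

/-- The zeta function of the set of concatenations is the inverse of `det (1 - B)`. -/
theorem zeta_core (hLoop : ∀ v, ¬ Adj v v) (hPos : ∀ v, 0 ∉ S v) {t : ℝ}
    (ht : |t| < 1 / (2 * (Fintype.card V + 1))) :
    ∃ L, HasSum (fun n : ℕ =>
        (perCount (SGraphCore Adj S) (n + 1) : ℝ) / (n + 1) * t ^ (n + 1)) L ∧
      (1 - genMatrix Adj S t).det * Real.exp L = 1 := by
  set c : ℝ := (Fintype.card V : ℝ)
  set ρ : ℝ := 1 / (2 * (c + 1)) with hρ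
  have hc0 : 0 ≤ c := Nat.cast_nonneg _
  have hρ0 : 0 < ρ := by positivity
  have hρ1 : |ρ| < 1 := by
    rw [abs_of_pos hρ0, hρ, div_lt_one (by positivity)]
    linarith
  have hcρ : c * |ρ| < 1 := by
    rw [abs_of_pos hρ0, hρ, mul_one_div, div_lt_one (by positivity)]
    linarith
  have hbound : ∀ n, 0 < n → (perCount (SGraphCore Adj S) n : ℝ) ≤ c ^ n := fun n hn =>
    (Nat.cast_le.2 (ncard_periodic_le (SGraphCore Adj S) n hn)).trans_eq (Nat.cast_pow _ _)
  let q : ℝ⟦X⟧ := PowerSeries.mk fun n => (perCount (SGraphCore Adj S) (n + 1) : ℝ)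
  let l : ℝ⟦X⟧ := PowerSeries.mk fun n => (perCount (SGraphCore Adj S) n : ℝ) / n
  have hq : q ∈ absConvergent ρ := by
    refine mem_absConvergent_of_abs_coeff_le (K := c) (M := c) (fun n => ?_) hc0 hcρ
    rw [coeff_mk, abs_of_nonneg (Nat.cast_nonneg _), ← pow_succ']
    exact hbound _ n.succ_pos
  have hl : l ∈ absConvergent ρ := by
    refine mem_absConvergent_of_abs_coeff_le (K := c) (M := 1) (fun n => ?_) hc0 hcρ
    rw [coeff_mk, abs_of_nonneg (by positivity), one_mul]
    rcases n.eq_zero_or_pos with rfl | hn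
    · simp
    · exact (div_le_self (Nat.cast_nonneg _) (by exact_mod_cast hn)).trans (hbound n hn)
  have hlq : derivative ℝ l = q := by
    ext n
    rw [coeff_derivative, coeff_mk, coeff_mk]
    push_cast
    field_simp
  have hl0 : coeff 0 l = 0 := by simp [l]
  have htρ : |t| ≤ |ρ| := ht.le.trans (le_abs_self ρ)
  refine ⟨evalReal l t, ?_, ?_⟩
  · have h : HasSum (fun n => coeff n l * t ^ n) (evalReal l t) :=
      (Summable.of_norm (absConvergent_mono htρ hl)).hasSum
    rw [← hasSum_nat_add_iff' 1] at h
    simpa [l] using h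
  · rw [← (evalReal_det_one_sub_genSeriesMatrix (htρ.trans_lt hρ1)).2]
    exact evalReal_mul_exp_eq_one (evalReal_det_one_sub_genSeriesMatrix hρ1).1 hq hl
      (derivative_det_one_sub_genSeriesMatrix hLoop hPos) hlq
      (coeff_zero_det_one_sub_genSeriesMatrix hPos) hl0 ht

end Zeta

/-- **Zeta function of S-graph shifts.**  Let `(G,S)` be an essential
set-equipped graph, `X = X(G,S)` and `B(t)` the generating matrix.  Then, as
analytic functions near `0`,
`ζ_X(t) = exp (∑_{n ≥ 1} p_n(X)/n · tⁿ) = 1 / ((1−t)^{p₁(X)} · det (I − B(t)))`. -/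
theorem zeta_SGraphShift {V : Type*} [Fintype V] [DecidableEq V] [Nonempty V]
    [TopologicalSpace V] [DiscreteTopology V]
    (Adj : V → V → Prop) [DecidableRel Adj] (S : V → Set ℕ)
    (hLoop : ∀ v, ¬ Adj v v)
    (hNe : ∀ v, (S v).Nonempty) (hPos : ∀ v, 0 ∉ S v)
    (hEss : ∀ v : V, (∃ u, Adj u v) ∧ (∃ w, Adj v w)) :
    ∃ ε : ℝ, 0 < ε ∧ ∀ t : ℝ, |t| < ε →
      Summable (fun n : ℕ =>
        (perCount (closure (SGraphCore Adj S)) (n + 1) : ℝ) / (n + 1) * t ^ (n + 1)) ∧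
      Real.exp (∑' n : ℕ,
          (perCount (closure (SGraphCore Adj S)) (n + 1) : ℝ) / (n + 1) * t ^ (n + 1)) =
        1 / ((1 - t) ^ perCount (closure (SGraphCore Adj S)) 1 *
          ((1 : Matrix V V ℝ) - genMatrix Adj S t).det) := by
  refine ⟨1 / (2 * (Fintype.card V + 1)), by positivity, fun t ht => ?_⟩
  have ht1 : |t| < 1 := ht.trans_le (by
    rw [div_le_one (by positivity)]
    linarith [Nat.cast_nonneg (α := ℝ) (Fintype.card V)])
  obtain ⟨L, hL, hdet⟩ := zeta_core hLoop hPos ht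
  set m := perCount (closure (SGraphCore Adj S)) 1 with hm
  have hlog := (Real.hasSum_pow_div_log_of_abs_lt_one ht1).mul_left (m : ℝ)
  have hsum : HasSum (fun n : ℕ =>
      (perCount (closure (SGraphCore Adj S)) (n + 1) : ℝ) / (n + 1) * t ^ (n + 1))
      (m * -Real.log (1 - t) + L) := by
    refine (hlog.add hL).congr_fun fun n => ?_
    rw [perCount_closure_core hLoop n.succ_pos, ← hm]
    push_cast
    ring
  refine ⟨hsum.summable, ?_⟩
  have h1t : 0 < 1 - t := by linarith [(abs_lt.1 ht1).2]
  rw [hsum.tsum_eq, Real.exp_add, mul_neg, Real.exp_neg, Real.exp_nat_mul, Real.exp_log h1t,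
    eq_one_div_of_mul_eq_one_right hdet, one_div, one_div, mul_inv]
end

section
/- Let (G,S) be an essential set-equipped graph. The S-graph shift X(G,S) is a subshift of finite type if and only if every set S_v ∈ S is either finite or cofinite in ℕ. -/
open Filter Topology

/-- `X` is a subshift of finite type: the set of points avoiding every word of
some finite set `F` of forbidden words. -/
def IsSFT {A : Type*} (X : Set (ℤ → A)) : Prop :=
  ∃ F : Set (List A), F.Finite ∧ X = {x | ∀ w ∈ F, ¬ Appears w x}

/-- The local conditions satisfied by concatenations of blocks: distinct neighbouring symbols are
adjacent in the graph, and finite maximal runs have admissible lengths. -/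
def LocallyAdmissible {V : Type*} (Adj : V → V → Prop) (S : V → Set ℕ) (x : ℤ → V) : Prop :=
  (∀ k, x (k - 1) ≠ x k → Adj (x (k - 1)) (x k)) ∧
  ∀ p q, p < q → x (p - 1) ≠ x p → x (q - 1) ≠ x q →
    (∀ k, p ≤ k → k < q → x k = x p) → (q - p).toNat ∈ S (x p)

/-- The sequence changes symbol arbitrarily far to the right. -/
def ChangesRight {V : Type*} (x : ℤ → V) : Prop := ∀ m, ∃ k, m < k ∧ x (k - 1) ≠ x k

/-- The sequence changes symbol arbitrarily far to the left. -/
def ChangesLeft {V : Type*} (x : ℤ → V) : Prop := ∀ m, ∃ k, k ≤ m ∧ x (k - 1) ≠ x k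

/-- Membership in the closure of a set of sequences over a discrete alphabet, via finite windows. -/
theorem mem_closure_iff_forall_window {V : Type*} [TopologicalSpace V] [DiscreteTopology V]
    (C : Set (ℤ → V)) (x : ℤ → V) :
    x ∈ closure C ↔ ∀ a b : ℤ, ∃ z ∈ C, ∀ k, a ≤ k → k ≤ b → z k = x k := by
  constructor
  · intro h a b
    have ho : IsOpen (Set.pi (Set.Icc a b) (fun k => ({x k} : Set V))) :=
      isOpen_set_pi (Set.finite_Icc a b) (fun _ _ => isOpen_discrete _)
    obtain ⟨z, hz, hzC⟩ := mem_closure_iff.1 h _ ho (fun k _ => rfl)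
    exact ⟨z, hzC, fun k h1 h2 => hz k ⟨h1, h2⟩⟩
  · intro h
    rw [mem_closure_iff]
    intro o ho hx
    obtain ⟨I, u, hu, hsub⟩ := isOpen_pi_iff.1 ho x hx
    obtain ⟨b, hb⟩ := I.bddAbove
    obtain ⟨a, ha⟩ := I.bddBelow
    obtain ⟨z, hz, hzx⟩ := h a b
    refine ⟨z, hsub fun k hk => ?_, hz⟩
    rw [hzx k (ha hk) (hb hk)]
    exact (hu k hk).2

/-- A set of integers unbounded in both directions is increasingly enumerated by `ℤ`. -/
theorem exists_strictMono_enumeration (B : Set ℤ) (hR : ∀ m, ∃ k ∈ B, m < k)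
    (hL : ∀ m, ∃ k ∈ B, k < m) :
    ∃ t : ℤ → ℤ, StrictMono t ∧ (∀ i, t i ∈ B) ∧ (∀ k ∈ B, ∃ i, t i = k) := by
  classical
  let _ : SuccOrder B := LinearLocallyFiniteOrder.succOrder B
  let _ : PredOrder B := LinearLocallyFiniteOrder.predOrder B
  have : NoMaxOrder B := ⟨fun a => by
    obtain ⟨k, hk, h⟩ := hR a; exact ⟨⟨k, hk⟩, h⟩⟩
  have : NoMinOrder B := ⟨fun a => by
    obtain ⟨k, hk, h⟩ := hL a; exact ⟨⟨k, hk⟩, h⟩⟩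
  have : Nonempty B := by
    obtain ⟨k, hk, _⟩ := hR 0; exact ⟨⟨k, hk⟩⟩
  let e : B ≃o ℤ := orderIsoIntOfLinearSuccPredArch
  exact ⟨fun i => e.symm i, fun i j h => e.symm.strictMono h, fun i => (e.symm i).2,
    fun k hk => ⟨e ⟨k, hk⟩, by simp⟩⟩

theorem mem_SGraphCore_iff {V : Type*} {Adj : V → V → Prop} {S : V → Set ℕ}
    (hLoop : ∀ v, ¬ Adj v v) (x : ℤ → V) :
    x ∈ SGraphCore Adj S ↔ LocallyAdmissible Adj S x ∧ ChangesRight x ∧ ChangesLeft x := by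
  constructor
  · rintro ⟨a, t, ht, hS, hA, hx, hc⟩
    have hta : ∀ i, x (t i) = a i := fun i => hx i _ le_rfl (ht (by lia))
    have htp : ∀ i, x (t i - 1) = a (i - 1) := fun i => by
      have h := ht (show i - 1 < i by lia)
      refine hx (i - 1) _ (by lia) ?_
      rw [sub_add_cancel]; lia
    have hadj : ∀ i, Adj (x (t i - 1)) (x (t i)) := fun i => by
      have h := hA (i - 1)
      rw [sub_add_cancel] at h
      rwa [hta, htp]
    have hne : ∀ i, x (t i - 1) ≠ x (t i) := fun i h => hLoop (x (t i)) (by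
      have := hadj i; rwa [h] at this)
    have hb : ∀ k, x (k - 1) ≠ x k → ∃ i, k = t i := fun k hk => by
      obtain ⟨i, h1, h2⟩ := hc k
      refine ⟨i, ?_⟩
      by_contra hki
      exact hk (by rw [hx i k h1 h2, hx i (k - 1) (by lia) (by lia)])
    refine ⟨⟨fun k hk => ?_, fun p q hpq hp hq hconst => ?_⟩, fun m => ?_, fun m => ?_⟩
    · obtain ⟨i, rfl⟩ := hb k hk
      exact hadj i
    · obtain ⟨i, rfl⟩ := hb p hp
      obtain ⟨j, rfl⟩ := hb q hq
      have hij : i < j := ht.lt_iff_lt.1 hpq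
      have hij' : j = i + 1 := by
        by_contra hne'
        have h1 : t i < t (i + 1) := ht (by lia)
        have h2 : t (i + 1) < t j := ht (by lia)
        exact hne (i + 1) (by rw [hconst _ (by lia) (by lia), hconst _ h1.le h2])
      rw [hij', hta]
      exact hS i
    · obtain ⟨i, _, h⟩ := hc m
      exact ⟨_, h, hne _⟩
    · obtain ⟨i, h, _⟩ := hc m
      exact ⟨_, h, hne _⟩
  · rintro ⟨⟨hadj, hrun⟩, hR, hL⟩
    obtain ⟨t, ht, hB, hsurj⟩ := exists_strictMono_enumeration {k | x (k - 1) ≠ x k}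
      (fun m => by obtain ⟨k, h, h'⟩ := hR m; exact ⟨k, h', h⟩)
      (fun m => by obtain ⟨k, h, h'⟩ := hL (m - 1); exact ⟨k, h', by lia⟩)
    have hgap : ∀ i k, t i < k → k < t (i + 1) → x (k - 1) = x k := by
      intro i k h1 h2
      by_contra hk
      obtain ⟨j, rfl⟩ := hsurj k hk
      have := ht.lt_iff_lt.1 h1
      have := ht.lt_iff_lt.1 h2
      lia
    have hconst : ∀ i k, t i ≤ k → k < t (i + 1) → x k = x (t i) := by
      intro i k h
      induction k, h using Int.leInduction with
      | base => exact fun _ => rfl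
      | succ k hk ih =>
        intro h2
        have := hgap i (k + 1) (by lia) h2
        rw [add_sub_cancel_right] at this
        rw [← this, ih (by lia)]
    refine ⟨fun i => x (t i), t, ht, fun i => ?_, fun i => ?_, hconst, fun m => ?_⟩
    · exact hrun _ _ (ht (by lia)) (hB i) (hB _) (hconst i)
    · have h : t i < t (i + 1) := ht (by lia)
      have := hadj _ (hB (i + 1))
      rwa [hconst i _ (by lia) (by lia)] at this
    · obtain ⟨k, hk, hkb⟩ := hL m
      obtain ⟨i₀, rfl⟩ := hsurj k hkb
      obtain ⟨k', hk', hkb'⟩ := hR m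
      obtain ⟨j₀, rfl⟩ := hsurj k' hkb'
      obtain ⟨i, hi, hmax⟩ := Int.exists_greatest_of_bdd (P := fun i => t i ≤ m)
        ⟨j₀, fun z hz => by
          have : t z < t j₀ := lt_of_le_of_lt hz hk'
          exact (ht.lt_iff_lt.1 this).le⟩ ⟨i₀, hk⟩
      refine ⟨i, hi, ?_⟩
      by_contra hcon
      have := hmax (i + 1) (by lia)
      lia

/-- Integer-indexed partial sums. -/
theorem exists_int_partialSums (n : ℤ → ℤ) :
    ∃ t : ℤ → ℤ, t 0 = 0 ∧ ∀ i, t (i + 1) = t i + n i := by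
  refine ⟨fun i => ∑ j ∈ Finset.Ico 0 i, n j - ∑ j ∈ Finset.Ico i 0, n j, by simp, fun i => ?_⟩
  rcases le_or_gt 0 i with h | h
  · have h1 : Finset.Ico 0 (i + 1) = insert i (Finset.Ico 0 i) := by
      ext k; simp only [Finset.mem_Ico, Finset.mem_insert]; lia
    have h2 : Finset.Ico (i + 1) 0 = ∅ := Finset.Ico_eq_empty (by lia)
    have h3 : Finset.Ico i 0 = ∅ := Finset.Ico_eq_empty (by lia)
    simp only [h1, h2, h3]
    rw [Finset.sum_insert (by simp)]
    simp only [Finset.sum_empty]; ring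
  · have h1 : Finset.Ico i 0 = insert i (Finset.Ico (i + 1) 0) := by
      ext k; simp only [Finset.mem_Ico, Finset.mem_insert]; lia
    have h2 : Finset.Ico 0 (i + 1) = ∅ := Finset.Ico_eq_empty (by lia)
    have h3 : Finset.Ico 0 i = ∅ := Finset.Ico_eq_empty (by lia)
    simp only [h1, h2, h3]
    rw [Finset.sum_insert (by simp)]
    simp only [Finset.sum_empty]; ring

/-- Every vertex of an essential graph lies on a bi-infinite path. -/
theorem exists_biinfinite_path {V : Type*} {Adj : V → V → Prop}
    (hEss : ∀ v : V, (∃ u, Adj u v) ∧ (∃ w, Adj v w)) (v : V) :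
    ∃ a : ℤ → V, a 0 = v ∧ ∀ i, Adj (a i) (a (i + 1)) := by
  choose g hg using fun v => (hEss v).1
  choose f hf using fun v => (hEss v).2
  refine ⟨fun i => if 0 ≤ i then f^[i.toNat] v else g^[(-i).toNat] v, by simp, fun i => ?_⟩
  dsimp only
  rcases le_or_gt 0 i with h | h
  · rw [if_pos h, if_pos (by lia), show (i + 1).toNat = i.toNat + 1 by lia,
      Function.iterate_succ_apply']
    exact hf _
  · have h1 : (-i).toNat = (-(i + 1)).toNat + 1 := by lia
    rw [if_neg (by lia), h1, Function.iterate_succ_apply']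
    split_ifs with h0
    · obtain rfl : i = -1 := by lia
      exact hg _
    · exact hg _

/-- Any admissible block `v ^ n` occurs as a maximal run in a concatenation of blocks. -/
theorem exists_mem_SGraphCore_block {V : Type*} {Adj : V → V → Prop} {S : V → Set ℕ}
    (hLoop : ∀ v, ¬ Adj v v) (hNe : ∀ v, (S v).Nonempty) (hPos : ∀ v, 0 ∉ S v)
    (hEss : ∀ v : V, (∃ u, Adj u v) ∧ (∃ w, Adj v w)) (v : V) (n : ℕ) (hn : n ∈ S v) :
    ∃ z ∈ SGraphCore Adj S, z (-1) ≠ v ∧ (∀ k : ℤ, 0 ≤ k → k < n → z k = v) ∧ z n ≠ v := by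
  obtain ⟨a, ha0, ha⟩ := exists_biinfinite_path hEss v
  choose c hc using hNe
  let l : ℤ → ℕ := fun i => if i = 0 then n else c (a i)
  have hl0 : l 0 = n := if_pos rfl
  have hl : ∀ i, l i ∈ S (a i) := fun i => by
    by_cases h : i = 0
    · rw [h, hl0, ha0]; exact hn
    · simp only [l, if_neg h]; exact hc _
  have hlpos : ∀ i, 0 < l i := fun i =>
    Nat.pos_of_ne_zero fun h => hPos (a i) (h ▸ hl i)
  obtain ⟨t, ht0, ht⟩ := exists_int_partialSums (fun i => (l i : ℤ))
  have htm : StrictMono t := strictMono_int_of_lt_succ fun i => by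
    rw [ht]; have := hlpos i; lia
  have hge : ∀ i : ℤ, 0 ≤ i → i ≤ t i := fun i hi => by
    induction i, hi using Int.leInduction with
    | base => rw [ht0]
    | succ k hk ih => rw [ht]; have := hlpos k; lia
  have hle : ∀ i : ℤ, i ≤ 0 → t i ≤ i := fun i hi => by
    induction i, hi using Int.leInductionDown with
    | base => rw [ht0]
    | pred k hk ih =>
      have := ht (k - 1)
      rw [sub_add_cancel] at this
      have := hlpos (k - 1); lia
  have hcov : ∀ m : ℤ, ∃ i : ℤ, t i ≤ m ∧ m < t (i + 1) := fun m => by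
    obtain ⟨i, hi, hmax⟩ := Int.exists_greatest_of_bdd (P := fun i => t i ≤ m)
      ⟨max m 0, fun z hz => by
        rcases le_total 0 z with h | h
        · have := hge z h; exact le_max_of_le_left (by lia)
        · exact le_max_of_le_right h⟩
      ⟨min m 0, (hle _ (min_le_right _ _)).trans (min_le_left _ _)⟩
    refine ⟨i, hi, ?_⟩
    by_contra hcon
    have := hmax (i + 1) (by lia)
    lia
  choose b hb1 hb2 using hcov
  have huniq : ∀ i k : ℤ, t i ≤ k → k < t (i + 1) → b k = i := fun i k h1 h2 => by
    have e1 : t (b k) < t (i + 1) := (hb1 k).trans_lt h2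
    have e2 : t i < t (b k + 1) := h1.trans_lt (hb2 k)
    have := htm.lt_iff_lt.1 e1
    have := htm.lt_iff_lt.1 e2
    lia
  have hblock : ∀ i k : ℤ, t i ≤ k → k < t (i + 1) → a (b k) = a i := fun i k h1 h2 => by
    rw [huniq i k h1 h2]
  have hne : ∀ i, a i ≠ a (i + 1) := fun i h => hLoop (a i) (by
    have := ha i; rwa [← h] at this)
  have ht1 : t 1 = n := by
    have := ht 0
    rw [zero_add, ht0, hl0] at this; lia
  refine ⟨fun k => a (b k), ⟨a, t, htm, fun i => ?_, ha, hblock, fun m => ⟨b m, hb1 m, hb2 m⟩⟩,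
    ?_, fun k h1 h2 => ?_, ?_⟩
  · rw [ht]; simpa using hl i
  · have e := hblock (-1) (-1) (hle _ (by lia)) (by norm_num [ht0])
    dsimp only
    rw [e, ← ha0]
    exact hne (-1)
  · dsimp only
    rw [hblock 0 k (by lia) (by rw [zero_add]; lia), ha0]
  · have e := hblock 1 n ht1.le (by rw [← ht1]; exact htm (by lia))
    dsimp only
    rw [e, ← ha0]
    exact (hne 0).symm

/-- A long constant window in a concatenation of blocks comes from a long block. -/
theorem exists_mem_gt_of_const_window {V : Type*} {Adj : V → V → Prop} {S : V → Set ℕ}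
    (hLoop : ∀ v, ¬ Adj v v) {z : ℤ → V} (hz : z ∈ SGraphCore Adj S) (v : V) (p : ℤ) (N : ℕ)
    (h : ∀ k, p ≤ k → k ≤ p + N → z k = v) : ∃ n ∈ S v, N < n := by
  obtain ⟨a, t, ht, hS, hA, hx, hc⟩ := hz
  obtain ⟨i, h1, h2⟩ := hc p
  have hpi : a i = v := by rw [← hx i p h1 h2, h p le_rfl (by lia)]
  refine ⟨_, hpi ▸ hS i, ?_⟩
  by_contra hcon
  have e1 := h (t (i + 1)) h2.le (by lia)
  rw [hx (i + 1) _ le_rfl (ht (by lia))] at e1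
  have := hA i
  rw [e1, hpi] at this
  exact hLoop _ this

/-- A locally admissible sequence can be modified far to the right so as to change symbol
infinitely often there. -/
theorem LocallyAdmissible.exists_changesRight {V : Type*} {Adj : V → V → Prop} {S : V → Set ℕ}
    (hLoop : ∀ v, ¬ Adj v v) (hNe : ∀ v, (S v).Nonempty) (hPos : ∀ v, 0 ∉ S v)
    (hEss : ∀ v : V, (∃ u, Adj u v) ∧ (∃ w, Adj v w)) (N : ℕ) {x : ℤ → V}
    (hx : LocallyAdmissible Adj S x)
    (hR : ∀ v m, (∀ k, m ≤ k → x k = v) → ∀ n, N < n → n ∈ S v) (m : ℤ) :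
    ∃ z, LocallyAdmissible Adj S z ∧ ChangesRight z ∧ ∀ k, k ≤ m → z k = x k := by
  by_cases hc : ChangesRight x
  · exact ⟨x, hx, hc, fun _ _ => rfl⟩
  obtain ⟨m₀, hm₀⟩ : ∃ m₀, ∀ k, m₀ < k → x (k - 1) = x k := by
    simpa only [ChangesRight, not_forall, not_exists, not_and, not_not] using hc
  set v := x m₀ with hv
  have hconst : ∀ k, m₀ ≤ k → x k = v := fun k hk => by
    induction k, hk using Int.leInduction with
    | base => rfl
    | succ k hk ih =>
      have := hm₀ (k + 1) (by lia)
      rw [add_sub_cancel_right] at this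
      rw [← this, ih]
  have hSv := hR v m₀ hconst
  obtain ⟨w, hvw⟩ := (hEss v).2
  have hvw' : v ≠ w := fun h => hLoop v (by rwa [← h] at hvw)
  obtain ⟨n, hn⟩ := hNe w
  have hnpos : 0 < n := Nat.pos_of_ne_zero fun h => hPos w (h ▸ hn)
  obtain ⟨y, hy, hy1, hy2, -⟩ := exists_mem_SGraphCore_block hLoop hNe hPos hEss w n hn
  have hy0 : y 0 = w := hy2 0 le_rfl (by lia)
  obtain ⟨⟨hyadj, hyrun⟩, hyR, -⟩ := (mem_SGraphCore_iff hLoop y).1 hy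
  obtain ⟨q, hqm, hqN⟩ : ∃ q : ℤ, m < q ∧ m₀ + N + 1 ≤ q :=
    ⟨max (m + 1) (m₀ + N + 1), by
      have := le_max_left (m + 1) (m₀ + N + 1); lia, le_max_right _ _⟩
  obtain ⟨z, hzl, hzr⟩ : ∃ z : ℤ → V, (∀ k, k < q → z k = x k) ∧ ∀ k, q ≤ k → z k = y (k - q) :=
    ⟨fun k => if k < q then x k else y (k - q), fun k hk => if_pos hk,
      fun k hk => if_neg (by lia)⟩
  have hzq : z q = w := by rw [hzr q le_rfl, sub_self, hy0]
  have hzq' : z (q - 1) = v := by rw [hzl _ (by lia), hconst _ (by lia)]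
  have hyb : ∀ k, q ≤ k → z (k - 1) ≠ z k → y (k - q - 1) ≠ y (k - q) := fun k hk hne => by
    rcases hk.eq_or_lt with rfl | hk
    · rw [sub_self, hy0]; exact hy1
    · rwa [hzr k hk.le, hzr (k - 1) (by lia), sub_right_comm] at hne
  refine ⟨z, ⟨fun k hne => ?_, fun p r hpr hp hr hcst => ?_⟩, fun M => ?_,
    fun k hk => hzl k (by lia)⟩
  · rcases lt_trichotomy k q with hk | rfl | hk
    · rw [hzl k hk, hzl (k - 1) (by lia)] at hne ⊢
      exact hx.1 k hne
    · rwa [hzq, hzq']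
    · have := hyadj _ (hyb k hk.le hne)
      rwa [hzr k hk.le, hzr (k - 1) (by lia), sub_right_comm]
  · rcases lt_trichotomy r q with hk | rfl | hk
    · rw [hzl p (by lia)] at hcst ⊢
      rw [hzl p (by lia), hzl (p - 1) (by lia)] at hp
      rw [hzl r (by lia), hzl (r - 1) (by lia)] at hr
      exact hx.2 p r hpr hp hr fun k h1 h2 => by rw [← hcst k h1 h2, hzl k (by lia)]
    · rw [hzl p hpr, hzl (p - 1) (by lia)] at hp
      have hpm : p ≤ m₀ := by
        by_contra hcon
        exact hp (hm₀ p (by lia))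
      rw [← hcst (r - 1) (by lia) (by lia), hzq']
      exact hSv _ (by lia)
    · have hqp : q ≤ p := by
        by_contra hcon
        apply hvw'
        rw [← hzq, ← hzq', hcst q (by lia) hk, hcst (q - 1) (by lia) (by lia)]
      have := hyrun (p - q) (r - q) (by lia) (hyb p hqp hp) (hyb r hk.le hr)
        (fun k h1 h2 => by
          have e := hcst (k + q) (by lia) (by lia)
          rwa [hzr _ (by lia), hzr _ hqp, add_sub_cancel_right] at e)
      rwa [hzr p hqp, show r - p = r - q - (p - q) by ring]
  · obtain ⟨k, hk, hne⟩ := hyR (max (M - q) 0)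
    have h1 := le_max_left (M - q) 0
    have h2 := le_max_right (M - q) 0
    refine ⟨k + q, by lia, ?_⟩
    rw [hzr _ (by lia), hzr (k + q) (by lia), add_sub_cancel_right,
      show k + q - 1 - q = k - 1 by ring]
    exact hne

theorem LocallyAdmissible.reflect {V : Type*} {Adj : V → V → Prop} {S : V → Set ℕ} {x : ℤ → V}
    (hx : LocallyAdmissible Adj S x) :
    LocallyAdmissible (fun u v => Adj v u) S (fun k => x (-k)) := by
  refine ⟨fun k hne => ?_, fun p q hpq hp hq hc => ?_⟩
  · dsimp only at hne ⊢
    have := hx.1 (-(k - 1))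
    rw [show -(k - 1) - 1 = -k by ring] at this
    exact this hne.symm
  · dsimp only at hp hq hc ⊢
    have e : x (-(q - 1)) = x (-p) := hc (q - 1) (by lia) (by lia)
    have := hx.2 (-(q - 1)) (-(p - 1)) (by lia)
      (by rw [show -(q - 1) - 1 = -q by ring]; exact hq.symm)
      (by rw [show -(p - 1) - 1 = -p by ring]; exact hp.symm)
      (fun k h1 h2 => by
        have := hc (-k) (by lia) (by lia)
        rw [neg_neg] at this
        rw [this, e])
    rwa [e, show -(p - 1) - -(q - 1) = q - p by ring] at this

/-- A locally admissible sequence whose infinite runs only involve symbols with cofinitely many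
admissible lengths lies in the `S`-graph shift. -/
theorem LocallyAdmissible.mem_closure {V : Type*} [TopologicalSpace V] [DiscreteTopology V]
    {Adj : V → V → Prop} {S : V → Set ℕ}
    (hLoop : ∀ v, ¬ Adj v v) (hNe : ∀ v, (S v).Nonempty) (hPos : ∀ v, 0 ∉ S v)
    (hEss : ∀ v : V, (∃ u, Adj u v) ∧ (∃ w, Adj v w)) (N : ℕ) {x : ℤ → V}
    (hx : LocallyAdmissible Adj S x)
    (hR : ∀ v m, (∀ k, m ≤ k → x k = v) → ∀ n, N < n → n ∈ S v)
    (hL : ∀ v m, (∀ k, k ≤ m → x k = v) → ∀ n, N < n → n ∈ S v) :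
    x ∈ closure (SGraphCore Adj S) := by
  rw [mem_closure_iff_forall_window]
  intro a b
  obtain ⟨y, hy, hyR, hyx⟩ := hx.exists_changesRight hLoop hNe hPos hEss N hR b
  have hy' : LocallyAdmissible (fun u v => Adj v u) S (fun k => y (-k)) := hy.reflect
  obtain ⟨z, hz, hzR, hzy⟩ := LocallyAdmissible.exists_changesRight (Adj := fun u v => Adj v u)
    hLoop hNe hPos (fun v => (hEss v).symm) N hy'
    (fun v m h => hL v (min (-m) b) fun k hk => by
      have h1 := le_min_iff.1 hk
      rw [← hyx k h1.2]
      simpa using h (-k) (by lia)) (-a)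
  have hz' : LocallyAdmissible Adj S (fun k => z (-k)) :=
    LocallyAdmissible.reflect (Adj := fun u v => Adj v u) hz
  refine ⟨fun k => z (-k), (mem_SGraphCore_iff hLoop _).2 ⟨hz', fun M => ?_, fun M => ?_⟩,
    fun k h1 h2 => ?_⟩
  · obtain ⟨k, hk, hne⟩ := hyR (max M a)
    obtain ⟨h1, h2⟩ := max_lt_iff.1 hk
    refine ⟨k, h1, ?_⟩
    dsimp only
    rwa [hzy (-k) (by lia), hzy (-(k - 1)) (by lia), neg_neg, neg_neg]
  · obtain ⟨k, hk, hne⟩ := hzR (-M)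
    refine ⟨-(k - 1), by lia, ?_⟩
    dsimp only
    rw [show -(-(k - 1) - 1) = k by ring, neg_neg]
    exact hne.symm
  · dsimp only
    rw [hzy (-k) (by lia), neg_neg, hyx k h2]

/-- If every length-`N + 2` window of `x` occurs in a concatenation of blocks, and `N` bounds the
exceptional lengths of every vertex, then `x` lies in the `S`-graph shift. -/
theorem mem_closure_SGraphCore_of_windows {V : Type*} [TopologicalSpace V] [DiscreteTopology V]
    {Adj : V → V → Prop} {S : V → Set ℕ}
    (hLoop : ∀ v, ¬ Adj v v) (hNe : ∀ v, (S v).Nonempty) (hPos : ∀ v, 0 ∉ S v)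
    (hEss : ∀ v : V, (∃ u, Adj u v) ∧ (∃ w, Adj v w)) (N : ℕ)
    (hN : ∀ v, (∀ n ∈ S v, n ≤ N) ∨ ∀ n, N < n → n ∈ S v) {x : ℤ → V}
    (hx : ∀ j : ℤ, ∃ z ∈ SGraphCore Adj S, ∃ d : ℤ, ∀ k, j ≤ k → k < j + (N + 2) →
      z (k + d) = x k) :
    x ∈ closure (SGraphCore Adj S) := by
  have hlong : ∀ (v : V) (p : ℤ), (∀ k, p ≤ k → k ≤ p + N → x k = v) → ∀ n, N < n → n ∈ S v := by
    intro v p h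
    obtain ⟨z, hz, d, hzx⟩ := hx p
    obtain ⟨n, hn, hNn⟩ := exists_mem_gt_of_const_window hLoop hz v (p + d) N fun k h1 h2 => by
      have := hzx (k - d) (by lia) (by lia)
      rw [sub_add_cancel] at this
      rw [this, h _ (by lia) (by lia)]
    exact (hN v).resolve_left fun hfin => by have := hfin n hn; lia
  refine LocallyAdmissible.mem_closure hLoop hNe hPos hEss N
    ⟨fun k hne => ?_, fun p q hpq hp hq hc => ?_⟩
    (fun v m h => hlong v m fun k h1 _ => h k h1)
    (fun v m h => hlong v (m - N) fun k _ h2 => h k (by lia))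
  · obtain ⟨z, hz, d, hzx⟩ := hx (k - 1)
    have e1 := hzx (k - 1) le_rfl (by lia)
    have e2 := hzx k (by lia) (by lia)
    rw [show k - 1 + d = k + d - 1 by ring] at e1
    have := ((mem_SGraphCore_iff hLoop z).1 hz).1.1 (k + d)
    rw [e1, e2] at this
    exact this hne
  · rcases le_or_gt (q - p) N with hle | hgt
    · obtain ⟨z, hz, d, hzx⟩ := hx (p - 1)
      have e : ∀ k, p - 1 ≤ k → k ≤ q → z (k + d) = x k := fun k h1 h2 => hzx k h1 (by lia)
      have := ((mem_SGraphCore_iff hLoop z).1 hz).1.2 (p + d) (q + d) (by lia)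
        (by rwa [show p + d - 1 = p - 1 + d by ring, e _ le_rfl (by lia), e p (by lia) hpq.le])
        (by rwa [show q + d - 1 = q - 1 + d by ring, e _ (by lia) (by lia), e q (by lia) le_rfl])
        (fun k h1 h2 => by
          have := e (k - d) (by lia) (by lia)
          rw [sub_add_cancel] at this
          rw [this, e p (by lia) hpq.le, hc _ (by lia) (by lia)])
      rwa [e p (by lia) hpq.le, show q + d - (p + d) = q - p by ring] at this
    · exact hlong (x p) p (fun k h1 h2 => hc k h1 (by lia)) _ (by lia)

/-- If the `S`-graph shift is of finite type, long lengths below an admissible length are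
admissible. -/
theorem IsSFT.exists_bound_mem {V : Type*} [TopologicalSpace V] [DiscreteTopology V]
    {Adj : V → V → Prop} {S : V → Set ℕ}
    (hLoop : ∀ v, ¬ Adj v v) (hNe : ∀ v, (S v).Nonempty) (hPos : ∀ v, 0 ∉ S v)
    (hEss : ∀ v : V, (∃ u, Adj u v) ∧ (∃ w, Adj v w))
    (h : IsSFT (closure (SGraphCore Adj S))) :
    ∃ M : ℕ, ∀ v, ∀ n K : ℕ, M < n → n ≤ K → K ∈ S v → n ∈ S v := by
  obtain ⟨F, hF, hX⟩ := h
  obtain ⟨M, hM⟩ := (hF.image List.length).bddAbove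
  refine ⟨M, fun v n K hMn hnK hK => ?_⟩
  obtain ⟨x, hx, hx1, hx2, hx3⟩ := exists_mem_SGraphCore_block hLoop hNe hPos hEss v K hK
  have hxF : ∀ w ∈ F, ¬ Appears w x := by
    have : x ∈ closure (SGraphCore Adj S) := subset_closure hx
    rw [hX] at this
    exact this
  obtain ⟨y, hyl, hyr⟩ : ∃ y : ℤ → V, (∀ k : ℤ, k < n → y k = x k) ∧
      ∀ k : ℤ, 0 ≤ k → y k = x (k + (K - n)) := by
    refine ⟨fun k => if k < n then x k else x (k + (K - n)), fun k hk => if_pos hk,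
      fun k hk => ?_⟩
    dsimp only
    split_ifs with hkn
    · rw [hx2 k hk (by lia), hx2 _ (by lia) (by lia)]
    · rfl
  have hy : y ∈ closure (SGraphCore Adj S) := by
    rw [hX]
    rintro w hw ⟨j, hj⟩
    have hlen : w.length ≤ M := hM ⟨w, hw, rfl⟩
    rcases le_or_gt (j + w.length) n with hjn | hjn
    · refine hxF w hw ⟨j, fun i => ?_⟩
      rw [← hj i, hyl _ (by have := i.2; lia)]
    · refine hxF w hw ⟨j + (K - n), fun i => ?_⟩
      rw [← hj i, hyr _ (by lia), add_right_comm]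
  obtain ⟨z, hz, hzy⟩ := (mem_closure_iff_forall_window _ _).1 hy (-1) n
  have hzv : ∀ k : ℤ, 0 ≤ k → k < n → z k = v := fun k h1 h2 => by
    rw [hzy k (by lia) h2.le, hyl k h2, hx2 k h1 (by lia)]
  have hz0 : z 0 = v := hzv 0 le_rfl (by lia)
  have := ((mem_SGraphCore_iff hLoop z).1 hz).1.2 0 n (by lia)
    (by
      rw [hz0, zero_sub, hzy _ le_rfl (by lia), hyl _ (by lia)]
      exact hx1)
    (by
      rw [hzv _ (by lia) (by lia), hzy n (by lia) le_rfl, hyr _ (by lia), add_sub_cancel]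
      exact hx3.symm)
    (fun k h1 h2 => by rw [hz0, hzv k h1 h2])
  rw [hz0] at this
  simpa using this

/-- **SFT characterization.**  Let `(G,S)` be an essential set-equipped graph.
`X(G,S)` is a subshift of finite type iff every `S_v` is finite or cofinite in
the positive natural numbers. -/
theorem isSFT_SGraphShift_iff {V : Type*} [Fintype V]
    [TopologicalSpace V] [DiscreteTopology V]
    (Adj : V → V → Prop) (S : V → Set ℕ)
    (hLoop : ∀ v, ¬ Adj v v)
    (hNe : ∀ v, (S v).Nonempty) (hPos : ∀ v, 0 ∉ S v)
    (hEss : ∀ v : V, (∃ u, Adj u v) ∧ (∃ w, Adj v w)) :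
    IsSFT (closure (SGraphCore Adj S)) ↔
      ∀ v, (S v).Finite ∨ {n : ℕ | 0 < n ∧ n ∉ S v}.Finite := by
  constructor
  · intro h v
    obtain ⟨M, hM⟩ := h.exists_bound_mem hLoop hNe hPos hEss
    refine or_iff_not_imp_left.2 fun hinf => (Set.finite_Iic M).subset fun n hn => ?_
    by_contra hnM
    obtain ⟨K, hK, hnK⟩ := Set.Infinite.exists_gt hinf n
    exact hn.2 (hM v n K (not_le.1 hnM) hnK.le hK)
  · intro h
    have hbd : ∀ v, ∃ N : ℕ, (∀ n ∈ S v, n ≤ N) ∨ ∀ n, N < n → n ∈ S v := fun v => by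
      rcases h v with hf | hf
      · obtain ⟨N, hN⟩ := hf.bddAbove
        exact ⟨N, Or.inl fun n hn => hN hn⟩
      · obtain ⟨N, hN⟩ := hf.bddAbove
        refine ⟨N, Or.inr fun n hn => ?_⟩
        by_contra hnS
        exact absurd (hN ⟨by lia, hnS⟩) (not_le.2 hn)
    choose b hb using hbd
    obtain ⟨N, hN⟩ : ∃ N, ∀ v, b v ≤ N := ⟨Finset.univ.sup b, fun v => Finset.le_sup (by simp)⟩
    refine ⟨{w | w.length = N + 2 ∧ ¬ InLanguage (SGraphCore Adj S) w},
      (List.finite_length_eq V (N + 2)).subset fun w hw => hw.1, Set.Subset.antisymm ?_ ?_⟩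
    · rintro x hx w ⟨-, hw⟩ ⟨j, hj⟩
      obtain ⟨z, hz, hzx⟩ := (mem_closure_iff_forall_window _ _).1 hx j (j + w.length)
      refine hw ⟨z, hz, j, fun i => ?_⟩
      rw [hzx _ (by lia) (by have := i.2; lia), hj i]
    · intro x hx
      refine mem_closure_SGraphCore_of_windows hLoop hNe hPos hEss N (fun v => ?_) fun j => ?_
      · exact (hb v).imp (fun h n hn => (h n hn).trans (hN v))
          fun h n hn => h n ((hN v).trans_lt hn)
      · let w := List.ofFn fun i : Fin (N + 2) => x (j + (i : ℕ))
        have hw : InLanguage (SGraphCore Adj S) w := by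
          by_contra hcon
          exact hx w ⟨by simp [w], hcon⟩ ⟨j, fun i => by simp only [w, List.get_ofFn, Fin.val_cast]⟩
        obtain ⟨z, hz, k', hk'⟩ := hw
        refine ⟨z, hz, k' - j, fun k h1 h2 => ?_⟩
        have := hk' ⟨(k - j).toNat, by simp only [w, List.length_ofFn]; lia⟩
        simp only [w, List.get_ofFn, Fin.val_cast] at this
        rw [Int.toNat_of_nonneg (by lia)] at this
        rw [show k + (k' - j) = k' + (k - j) by ring, this, add_sub_cancel]
end

section
/- Let (G,S) be an essential set-equipped graph. The S-graph shift X(G,S) has the weak specification property if and only if G is irreducible and sup Δ(S_v) < ∞ for every vertex v ∈ V(G). -/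
open Filter Topology

/-- `X` has the weak specification property: there is `N` such that any two
words of the language can be glued with a connecting word of length at most
`N`. -/
def HasWeakSpecification {A : Type*} (X : Set (ℤ → A)) : Prop :=
  ∃ N : ℕ, ∀ α β : List A, InLanguage X α → InLanguage X β →
    ∃ γ : List A, γ.length ≤ N ∧ InLanguage X (α ++ γ ++ β)

/-- `sup Δ(S) < ∞`: the difference sequence of `S` is bounded.  For a finite set
this holds trivially; for an infinite set it says that each element of `S` is
followed by another element of `S` within a bounded distance. -/
def SupDeltaFinite (S : Set ℕ) : Prop :=
  S.Finite ∨ ∃ d : ℕ, ∀ s ∈ S, ∃ s' ∈ S, s < s' ∧ s' ≤ s + d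

/-- `(a, t)` decomposes `x` into blocks: on `[t i, t (i + 1))` the sequence `x` is constantly `a i`,
block lengths lie in the prescribed sets, and consecutive blocks follow edges. -/
def IsBlockDecomposition {V : Type*} (Adj : V → V → Prop) (S : V → Set ℕ)
    (x : ℤ → V) (a : ℤ → V) (t : ℤ → ℤ) : Prop :=
  StrictMono t ∧
    (∀ i : ℤ, (t (i + 1) - t i).toNat ∈ S (a i)) ∧
    (∀ i : ℤ, Adj (a i) (a (i + 1))) ∧
    (∀ i k : ℤ, t i ≤ k → k < t (i + 1) → x k = a i)

/-- The word of length `n` read in `x` from position `k` on. -/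
def wordAt {A : Type*} (x : ℤ → A) (k : ℤ) (n : ℕ) : List A :=
  List.ofFn fun i : Fin n => x (k + (i : ℕ))

/-- `x` has a decomposition in which a block of the symbol `u` ends just before position `c`. -/
def BlockEndsAt {V : Type*} (Adj : V → V → Prop) (S : V → Set ℕ)
    (x : ℤ → V) (c : ℤ) (u : V) : Prop :=
  ∃ a t, IsBlockDecomposition Adj S x a t ∧ t 0 = c ∧ a (-1) = u

/-- `x` has a decomposition in which a block of the symbol `v` starts at position `c`. -/
def BlockStartsAt {V : Type*} (Adj : V → V → Prop) (S : V → Set ℕ)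
    (x : ℤ → V) (c : ℤ) (v : V) : Prop :=
  ∃ a t, IsBlockDecomposition Adj S x a t ∧ t 0 = c ∧ a 0 = v

section Words

variable {A : Type*}

theorem inLanguage_wordAt {X : Set (ℤ → A)} {x : ℤ → A} (hx : x ∈ X) (k : ℤ) (n : ℕ) :
    InLanguage X (wordAt x k n) :=
  ⟨x, hx, k, fun i => by rw [List.get_eq_getElem]; simp [wordAt]⟩

theorem exists_eq_of_inLanguage_closure [TopologicalSpace A] [DiscreteTopology A]
    {X : Set (ℤ → A)} {w : List A} (h : InLanguage (closure X) w) :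
    ∃ x ∈ X, ∃ k : ℤ, ∀ (i : ℕ) (hi : i < w.length), x (k + i) = w[i] := by
  obtain ⟨x, hx, k, hk⟩ := h
  have hopen : IsOpen {y : ℤ → A | ∀ i : Fin w.length, y (k + (i : ℕ)) = w.get i} := by
    rw [Set.ofPred_forall]
    refine isOpen_iInter_of_finite fun i => ?_
    exact (isOpen_discrete ({w.get i} : Set A)).preimage
      (continuous_apply (A := fun _ : ℤ => A) (k + ((i : ℕ) : ℤ)))
  obtain ⟨y, hy, hyX⟩ := mem_closure_iff.1 hx _ hopen hk
  exact ⟨y, hyX, k, fun i hi => hy ⟨i, hi⟩⟩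

/-- Weak specification of `closure X` in terms of gluing windows of points of `X`. -/
theorem hasWeakSpecification_closure_iff [TopologicalSpace A] [DiscreteTopology A]
    {X : Set (ℤ → A)} :
    HasWeakSpecification (closure X) ↔
      ∃ N : ℕ, ∀ x ∈ X, ∀ y ∈ X, ∀ (k l : ℤ) (m n : ℕ), ∃ z ∈ X, ∃ p q : ℤ,
        p + m ≤ q ∧ q ≤ p + m + N ∧ (∀ i : ℕ, i < m → z (p + i) = x (k + i)) ∧
          ∀ i : ℕ, i < n → z (q + i) = y (l + i) := by
  constructor
  · rintro ⟨N, hN⟩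
    refine ⟨N, fun x hx y hy k l m n => ?_⟩
    obtain ⟨γ, hγ, hw⟩ := hN _ _ (inLanguage_wordAt (subset_closure hx) k m)
      (inLanguage_wordAt (subset_closure hy) l n)
    obtain ⟨z, hz, p, hp⟩ := exists_eq_of_inLanguage_closure hw
    have hlen (x : ℤ → A) (k : ℤ) (m : ℕ) : (wordAt x k m).length = m := by simp [wordAt]
    refine ⟨z, hz, p, p + m + γ.length, by omega, by omega, fun i hi => ?_, fun i hi => ?_⟩
    · rw [hp i (by simp only [List.length_append, hlen]; omega),
        List.getElem_append_left (by simp only [List.length_append, hlen]; omega),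
        List.getElem_append_left (by simp only [hlen]; omega)]
      simp [wordAt]
    · have := hp (m + γ.length + i) (by simp only [List.length_append, hlen]; omega)
      rw [List.getElem_append_right (by simp only [List.length_append, hlen]; omega)] at this
      simp only [List.length_append, hlen] at this
      simp only [wordAt, List.getElem_ofFn, Nat.add_sub_cancel_left] at this
      rw [← this]
      push_cast
      congr 1
      ring
  · rintro ⟨N, hN⟩
    refine ⟨N, fun α β hα hβ => ?_⟩
    obtain ⟨x, hx, k, hk⟩ := exists_eq_of_inLanguage_closure hα
    obtain ⟨y, hy, l, hl⟩ := exists_eq_of_inLanguage_closure hβ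
    obtain ⟨z, hz, p, q, h1, h2, h3, h4⟩ := hN x hx y hy k l α.length β.length
    obtain ⟨g, rfl⟩ : ∃ g : ℕ, q = p + α.length + g :=
      ⟨(q - (p + α.length)).toNat, by omega⟩
    refine ⟨wordAt z (p + α.length) g, by simp [wordAt]; omega, ?_⟩
    convert inLanguage_wordAt (subset_closure hz) p (α.length + g + β.length) using 1
    refine List.ext_getElem (by simp [wordAt, add_assoc]) fun i hi hi' => ?_
    have hlen : (wordAt z (p + α.length) g).length = g := by simp [wordAt]
    simp only [List.length_append, hlen] at hi
    have hR : (wordAt z p (α.length + g + β.length))[i] = z (p + i) := by simp [wordAt]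
    rw [hR]
    by_cases hc : i < α.length
    · rw [List.getElem_append_left (by simp only [List.length_append, hlen]; omega),
        List.getElem_append_left hc, h3 i hc, hk i hc]
    by_cases hd : i < α.length + g
    · rw [List.getElem_append_left (by simp only [List.length_append, hlen]; omega),
        List.getElem_append_right (by omega)]
      simp only [wordAt, List.getElem_ofFn]
      congr 1
      omega
    · rw [List.getElem_append_right (by simp only [List.length_append, hlen]; omega)]
      simp only [List.length_append, hlen]
      rw [← hl _ (by omega), ← h4 _ (by omega)]
      congr 1
      omega

end Words

theorem exists_strictMono_mem_Ico {t : ℤ → ℤ} (ht : StrictMono t) (m : ℤ) :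
    ∃ i : ℤ, t i ≤ m ∧ m < t (i + 1) := by
  have hup (n : ℕ) : t 0 + n ≤ t n := by
    induction n with
    | zero => simp
    | succ n ih => have := ht (show (n : ℤ) < (n + 1 : ℕ) by omega); omega
  have hdown (n : ℕ) : t (-n) ≤ t 0 - n := by
    induction n with
    | zero => simp
    | succ n ih => have := ht (show (-(n + 1 : ℕ) : ℤ) < -n by omega); omega
  obtain ⟨i, hi, hmax⟩ := Int.exists_greatest_of_bdd (P := fun i => t i ≤ m)
    ⟨(m - t 0).toNat, fun z hz => by
      by_contra hlt
      have h1 := hup (m - t 0).toNat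
      have h2 := ht (not_le.1 hlt)
      omega⟩
    ⟨-(t 0 - m).toNat, by have := hdown (t 0 - m).toNat; omega⟩
  refine ⟨i, hi, ?_⟩
  by_contra h
  have := hmax (i + 1) (not_lt.1 h)
  omega

theorem StrictMono.eq_of_mem_Ico {t : ℤ → ℤ} (ht : StrictMono t) {i j m : ℤ}
    (hi : t i ≤ m) (hi' : m < t (i + 1)) (hj : t j ≤ m) (hj' : m < t (j + 1)) : i = j := by
  have h1 := ht.lt_iff_lt.1 (hi.trans_lt hj')
  have h2 := ht.lt_iff_lt.1 (hj.trans_lt hi')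
  omega

/-- Every integer sequence has a discrete antiderivative vanishing at `0`. -/
theorem exists_int_antiderivative (l : ℤ → ℤ) :
    ∃ t : ℤ → ℤ, t 0 = 0 ∧ ∀ i, t (i + 1) = t i + l i := by
  refine ⟨fun n => ∑ i ∈ Finset.Ico 0 n, l i - ∑ i ∈ Finset.Ico n 0, l i, by simp, fun n => ?_⟩
  rcases le_or_gt 0 n with h | h
  · have e : Finset.Ico 0 (n + 1) = insert n (Finset.Ico 0 n) := by
      ext j; simp only [Finset.mem_Ico, Finset.mem_insert]; omega
    simp only [Finset.Ico_eq_empty_of_le h,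
      Finset.Ico_eq_empty_of_le (show (0 : ℤ) ≤ n + 1 by omega), e]
    rw [Finset.sum_insert (by simp)]
    simp [add_comm]
  · have e : Finset.Ico n 0 = insert n (Finset.Ico (n + 1) 0) := by
      ext j; simp only [Finset.mem_Ico, Finset.mem_insert]; omega
    simp only [Finset.Ico_eq_empty_of_le h.le,
      Finset.Ico_eq_empty_of_le (show n + 1 ≤ (0 : ℤ) by omega), e]
    rw [Finset.sum_insert (by simp)]
    simp

theorem SupDeltaFinite.exists_mem_Icc {S : Set ℕ} (h : SupDeltaFinite S) :
    ∃ D : ℕ, ∀ s ∈ S, ∀ m ≤ s, ∃ s' ∈ S, m ≤ s' ∧ s' ≤ m + D := by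
  rcases h with h | ⟨d, hd⟩
  · obtain ⟨D, hD⟩ := h.bddAbove
    exact ⟨D, fun s hs m hm => ⟨s, hs, hm, (hD hs).trans (Nat.le_add_left _ _)⟩⟩
  · rcases S.eq_empty_or_nonempty with rfl | ⟨s₀, hs₀⟩
    · exact ⟨0, by simp⟩
    refine ⟨s₀ + d, fun _ _ m _ => ?_⟩
    induction m with
    | zero => exact ⟨s₀, hs₀, by omega, by omega⟩
    | succ m ih =>
      obtain ⟨s, hs, h1, h2⟩ := ih (by omega)
      rcases h1.eq_or_lt with rfl | h1
      · obtain ⟨s', hs', h3, h4⟩ := hd _ hs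
        exact ⟨s', hs', by omega, by omega⟩
      · exact ⟨s, hs, by omega, by omega⟩

section Blocks

variable {V : Type*} {Adj : V → V → Prop} {S : V → Set ℕ}

theorem mem_SGraphCore_iff_s8 {x : ℤ → V} :
    x ∈ SGraphCore Adj S ↔ ∃ a t, IsBlockDecomposition Adj S x a t := by
  constructor
  · rintro ⟨a, t, h1, h2, h3, h4, -⟩
    exact ⟨a, t, h1, h2, h3, h4⟩
  · rintro ⟨a, t, h1, h2, h3, h4⟩
    exact ⟨a, t, h1, h2, h3, h4, exists_strictMono_mem_Ico h1⟩

namespace IsBlockDecomposition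

variable {x y a b : ℤ → V} {s t : ℤ → ℤ}

theorem reindex (h : IsBlockDecomposition Adj S x a t) (j : ℤ) :
    IsBlockDecomposition Adj S x (fun i => a (i + j)) (fun i => t (i + j)) := by
  obtain ⟨h1, h2, h3, h4⟩ := h
  refine ⟨fun i i' hi => h1 (by omega), fun i => ?_, fun i => ?_, fun i k => ?_⟩
  · simpa only [add_right_comm] using h2 (i + j)
  · simpa only [add_right_comm] using h3 (i + j)
  · simpa only [add_right_comm] using h4 (i + j) k

theorem translate (h : IsBlockDecomposition Adj S x a t) (c : ℤ) :
    IsBlockDecomposition Adj S (fun k => x (k - c)) a (fun i => t i + c) := by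
  obtain ⟨h1, h2, h3, h4⟩ := h
  refine ⟨fun i i' hi => by have := h1 hi; simpa using this, fun i => ?_, h3, fun i k hk hk' => ?_⟩
  · simpa using h2 i
  · simp only at hk hk'
    exact h4 i _ (by omega) (by omega)

theorem splice (hx : IsBlockDecomposition Adj S x a t) (hy : IsBlockDecomposition Adj S y b s)
    (hts : t 0 = s 0) (hadj : Adj (a (-1)) (b 0)) :
    IsBlockDecomposition Adj S (fun k => if k < t 0 then x k else y k)
      (fun i => if i < 0 then a i else b i) (fun i => if i < 0 then t i else s i) := by
  obtain ⟨h1, h2, h3, h4⟩ := hx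
  obtain ⟨g1, g2, g3, g4⟩ := hy
  have hnext (i : ℤ) (hi : i < 0) : (if i + 1 < 0 then t (i + 1) else s (i + 1)) = t (i + 1) := by
    split_ifs with h
    · rfl
    · obtain rfl : i = -1 := by omega
      simpa using hts.symm
  refine ⟨strictMono_int_of_lt_succ fun i => ?_, fun i => ?_, fun i => ?_, fun i k => ?_⟩
  · rcases lt_or_ge i 0 with hi | hi
    · simpa only [hnext i hi, hi, if_true] using h1 (lt_add_one i)
    · simpa only [not_lt.2 hi, show ¬ i + 1 < 0 by omega, if_false] using g1 (lt_add_one i)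
  · rcases lt_or_ge i 0 with hi | hi
    · simpa only [hnext i hi, hi, if_true] using h2 i
    · simpa only [not_lt.2 hi, show ¬ i + 1 < 0 by omega, if_false] using g2 i
  · rcases lt_trichotomy i (-1) with hi | rfl | hi
    · simpa only [show i < 0 by omega, show i + 1 < 0 by omega, if_true] using h3 i
    · simpa using hadj
    · simpa only [show ¬ i < 0 by omega, show ¬ i + 1 < 0 by omega, if_false] using g3 i
  · rcases lt_or_ge i 0 with hi | hi
    · simp only [hnext i hi, hi, if_true]
      intro hk hk'
      have : t (i + 1) ≤ t 0 := h1.monotone (by omega)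
      rw [if_pos (by omega)]
      exact h4 i k hk hk'
    · simp only [not_lt.2 hi, show ¬ i + 1 < 0 by omega, if_false]
      intro hk hk'
      have : s 0 ≤ s i := g1.monotone hi
      rw [if_neg (by omega)]
      exact g4 i k hk hk'

theorem reflTransGen (h : IsBlockDecomposition Adj S x a t) {p q : ℤ} (hpq : p ≤ q) :
    Relation.ReflTransGen Adj (x p) (x q) := by
  obtain ⟨h1, -, h3, h4⟩ := h
  obtain ⟨i, hi, hi'⟩ := exists_strictMono_mem_Ico h1 p
  obtain ⟨j, hj, hj'⟩ := exists_strictMono_mem_Ico h1 q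
  rw [h4 i p hi hi', h4 j q hj hj']
  have hij : i ≤ j := by
    have := h1.lt_iff_lt.1 ((hi.trans hpq).trans_lt hj')
    omega
  clear hj hj'
  induction j, hij using Int.leInduction with
  | base => exact .refl
  | succ j _ ih => exact ih.tail (h3 j)

end IsBlockDecomposition

/-- In an essential graph every admissible block occurs in some concatenation. -/
theorem exists_isBlockDecomposition (hNe : ∀ v, (S v).Nonempty) (hPos : ∀ v, 0 ∉ S v)
    (hEss : ∀ v : V, (∃ u, Adj u v) ∧ (∃ w, Adj v w)) {v : V} {n : ℕ} (hn : n ∈ S v) :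
    ∃ x a t, IsBlockDecomposition Adj S x a t ∧ a 0 = v ∧ t 0 = 0 ∧ t 1 = n := by
  obtain ⟨a, rfl, ha⟩ := exists_biinfinite_path hEss v
  have hl : ∀ i, ∃ m ∈ S (a i), i = 0 → m = n := fun i => by
    by_cases hi : i = 0
    · subst hi; exact ⟨n, hn, fun _ => rfl⟩
    · obtain ⟨m, hm⟩ := hNe (a i); exact ⟨m, hm, fun h => (hi h).elim⟩
  choose l hlS hl0 using hl
  obtain ⟨t, ht0, ht⟩ := exists_int_antiderivative fun i => l i
  have hmono : StrictMono t := strictMono_int_of_lt_succ fun i => by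
    have : l i ≠ 0 := fun h => hPos _ (h ▸ hlS i)
    rw [ht]
    omega
  choose idx hidx hidx' using exists_strictMono_mem_Ico hmono
  refine ⟨fun k => a (idx k), a, t, ⟨hmono, fun i => ?_, ha, fun i k hk hk' => ?_⟩, rfl, ht0, ?_⟩
  · rw [ht]
    simpa using hlS i
  · simp only
    rw [hmono.eq_of_mem_Ico (hidx k) (hidx' k) hk hk']
  · have := ht 0
    rw [hl0 0 rfl, ht0] at this
    simpa using this

theorem BlockEndsAt.splice_mem {x y : ℤ → V} {c : ℤ} {u v : V} (hx : BlockEndsAt Adj S x c u)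
    (hy : BlockStartsAt Adj S y c v) (huv : Adj u v) :
    (fun k => if k < c then x k else y k) ∈ SGraphCore Adj S := by
  obtain ⟨a, t, h, rfl, rfl⟩ := hx
  obtain ⟨b, s, g, hs, rfl⟩ := hy
  exact mem_SGraphCore_iff_s8.2 ⟨_, _, h.splice g hs.symm huv⟩

/-- A block of `v` may be appended after a block end. -/
theorem BlockEndsAt.append_block (hNe : ∀ v, (S v).Nonempty) (hPos : ∀ v, 0 ∉ S v)
    (hEss : ∀ v : V, (∃ u, Adj u v) ∧ (∃ w, Adj v w)) {x : ℤ → V} {c : ℤ} {u v : V} {n : ℕ}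
    (hx : BlockEndsAt Adj S x c u) (huv : Adj u v) (hn : n ∈ S v) :
    ∃ z, BlockEndsAt Adj S z (c + n) v ∧ (∀ k < c, z k = x k) ∧
      ∀ k, c ≤ k → k < c + n → z k = v := by
  obtain ⟨y, b, s, g, rfl, hs0, hs1⟩ := exists_isBlockDecomposition hNe hPos hEss hn
  obtain ⟨a, t, h, rfl, rfl⟩ := hx
  have key := h.splice (g.translate (t 0)) (by simp [hs0]) huv
  refine ⟨_, ⟨_, _, key.reindex 1, ?_, ?_⟩, fun k hk => if_pos hk, fun k hk hk' => ?_⟩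
  · simp [hs1, add_comm]
  · simp
  · simp only [not_lt.2 hk, if_false]
    exact g.2.2.2 0 _ (by omega) (by simp only [zero_add]; omega)

/-- A block of `v` may be prepended to a block start. -/
theorem BlockStartsAt.prepend_block (hNe : ∀ v, (S v).Nonempty) (hPos : ∀ v, 0 ∉ S v)
    (hEss : ∀ v : V, (∃ u, Adj u v) ∧ (∃ w, Adj v w)) {y : ℤ → V} {c : ℤ} {v w : V} {n : ℕ}
    (hy : BlockStartsAt Adj S y c w) (hvw : Adj v w) (hn : n ∈ S v) :
    ∃ z, BlockStartsAt Adj S z (c - n) v ∧ (∀ k, c ≤ k → z k = y k) ∧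
      ∀ k, c - n ≤ k → k < c → z k = v := by
  obtain ⟨x, a, t, g, rfl, ht0, ht1⟩ := exists_isBlockDecomposition hNe hPos hEss hn
  obtain ⟨b, s, h, rfl, rfl⟩ := hy
  have key := ((g.reindex 1).translate (s 0 - n)).splice h (by simp [ht1]) (by simpa using hvw)
  refine ⟨_, ⟨_, _, key.reindex (-1), ?_, ?_⟩, fun k hk => if_neg ?_, fun k hk hk' => ?_⟩
  · simp [ht0]
  · simp
  · simp [ht1, hk]
  · simp only [zero_add, ht1, add_sub_cancel, hk', if_true]
    exact g.2.2.2 0 _ (by omega) (by simp only [zero_add]; omega)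

theorem BlockStartsAt.translate {y : ℤ → V} {c : ℤ} {v : V} (hy : BlockStartsAt Adj S y c v)
    (d : ℤ) : BlockStartsAt Adj S (fun k => y (k - d)) (c + d) v := by
  obtain ⟨b, s, h, rfl, rfl⟩ := hy
  exact ⟨b, _, h.translate d, rfl, rfl⟩

/-- The block of `x` around position `c - 1` can be ended within bounded distance of `c`. -/
theorem exists_blockEndsAt (hNe : ∀ v, (S v).Nonempty) (hPos : ∀ v, 0 ∉ S v)
    (hEss : ∀ v : V, (∃ u, Adj u v) ∧ (∃ w, Adj v w)) {D : ℕ}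
    (hD : ∀ v, ∀ s ∈ S v, ∀ m ≤ s, ∃ s' ∈ S v, m ≤ s' ∧ s' ≤ m + D)
    {x : ℤ → V} (hx : x ∈ SGraphCore Adj S) (c : ℤ) :
    ∃ z u, ∃ r : ℕ, r ≤ D ∧ BlockEndsAt Adj S z (c + r) u ∧ ∀ k < c, z k = x k := by
  obtain ⟨a, t, h⟩ := mem_SGraphCore_iff_s8.1 hx
  obtain ⟨i, hi, hi'⟩ := exists_strictMono_mem_Ico h.1 (c - 1)
  obtain ⟨s', hs', h1, h2⟩ := hD _ _ (h.2.1 i) (c - t i).toNat (by omega)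
  have hend : BlockEndsAt Adj S x (t i) (a (i - 1)) :=
    ⟨_, _, h.reindex i, by simp, by ring_nf⟩
  obtain ⟨z, hz, hz1, hz2⟩ := hend.append_block hNe hPos hEss
    (by simpa using h.2.2.1 (i - 1)) hs'
  refine ⟨z, a i, (t i + s' - c).toNat, by omega, ?_, fun k hk => ?_⟩
  · convert hz using 1
    omega
  · rcases lt_or_ge k (t i) with hk' | hk'
    · exact hz1 k hk'
    · rw [hz2 k hk' (by omega), h.2.2.2 i k hk' (by omega)]

/-- The block of `y` around position `c` can be started within bounded distance of `c`. -/
theorem exists_blockStartsAt (hNe : ∀ v, (S v).Nonempty) (hPos : ∀ v, 0 ∉ S v)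
    (hEss : ∀ v : V, (∃ u, Adj u v) ∧ (∃ w, Adj v w)) {D : ℕ}
    (hD : ∀ v, ∀ s ∈ S v, ∀ m ≤ s, ∃ s' ∈ S v, m ≤ s' ∧ s' ≤ m + D)
    {y : ℤ → V} (hy : y ∈ SGraphCore Adj S) (c : ℤ) :
    ∃ z v, ∃ r : ℕ, r ≤ D ∧ BlockStartsAt Adj S z (c - r) v ∧ ∀ k, c ≤ k → z k = y k := by
  obtain ⟨b, s, h⟩ := mem_SGraphCore_iff_s8.1 hy
  obtain ⟨i, hi, hi'⟩ := exists_strictMono_mem_Ico h.1 c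
  obtain ⟨s', hs', h1, h2⟩ := hD _ _ (h.2.1 i) (s (i + 1) - c).toNat (by omega)
  have hstart : BlockStartsAt Adj S y (s (i + 1)) (b (i + 1)) :=
    ⟨_, _, h.reindex (i + 1), by simp, by simp⟩
  obtain ⟨z, hz, hz1, hz2⟩ := hstart.prepend_block hNe hPos hEss (h.2.2.1 i) hs'
  refine ⟨z, b i, (c - (s (i + 1) - s')).toNat, by omega, ?_, fun k hk => ?_⟩
  · convert hz using 1
    omega
  · rcases lt_or_ge k (s (i + 1)) with hlt | hge
    · rw [hz2 k (by omega) hlt, h.2.2.2 i k (by omega) hlt]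
    · exact hz1 k hge

/-- Along a path from `u` to `v`, a block of `u` can be continued by a bounded amount so that a
block of `v` may follow. -/
theorem exists_blockEndsAt_of_transGen (hNe : ∀ v, (S v).Nonempty) (hPos : ∀ v, 0 ∉ S v)
    (hEss : ∀ v : V, (∃ u, Adj u v) ∧ (∃ w, Adj v w)) {u v : V} (h : Relation.TransGen Adj u v) :
    ∃ L : ℕ, ∀ x c, BlockEndsAt Adj S x c u →
      ∃ w z, Adj w v ∧ BlockEndsAt Adj S z (c + L) w ∧ ∀ k < c, z k = x k := by
  induction h with
  | single huv => exact ⟨0, fun x c hx => ⟨u, x, huv, by simpa using hx, fun _ _ => rfl⟩⟩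
  | @tail v v' _ hvv' ih =>
    obtain ⟨L, hL⟩ := ih
    obtain ⟨n, hn⟩ := hNe v
    refine ⟨L + n, fun x c hx => ?_⟩
    obtain ⟨w, z, hwv, hz, hzx⟩ := hL x c hx
    obtain ⟨z', hz', hz1, -⟩ := hz.append_block hNe hPos hEss hwv hn
    refine ⟨v, z', hvv', by simpa [add_assoc] using hz', fun k hk => ?_⟩
    rw [hz1 k (by omega), hzx k hk]

end Blocks

theorem hasWeakSpecification_SGraphShift_of_transGen {V : Type*} [Finite V]
    [TopologicalSpace V] [DiscreteTopology V] {Adj : V → V → Prop} {S : V → Set ℕ}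
    (hNe : ∀ v, (S v).Nonempty) (hPos : ∀ v, 0 ∉ S v)
    (hEss : ∀ v : V, (∃ u, Adj u v) ∧ (∃ w, Adj v w))
    (hirr : ∀ u v : V, Relation.TransGen Adj u v) (hΔ : ∀ v, SupDeltaFinite (S v)) :
    HasWeakSpecification (closure (SGraphCore Adj S)) := by
  choose D₀ hD₀ using fun v => (hΔ v).exists_mem_Icc
  obtain ⟨D, hD⟩ := (Set.finite_range D₀).bddAbove
  have hD' : ∀ v, ∀ s ∈ S v, ∀ m ≤ s, ∃ s' ∈ S v, m ≤ s' ∧ s' ≤ m + D := fun v s hs m hm => by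
    obtain ⟨s', hs', h1, h2⟩ := hD₀ v s hs m hm
    have := hD (Set.mem_range_self v)
    exact ⟨s', hs', h1, by omega⟩
  choose L₀ hL₀ using fun p : V × V =>
    exists_blockEndsAt_of_transGen (S := S) hNe hPos hEss (hirr p.1 p.2)
  obtain ⟨L, hL⟩ := (Set.finite_range L₀).bddAbove
  refine hasWeakSpecification_closure_iff.2 ⟨D + L + D, fun x hx y hy k l m n => ?_⟩
  obtain ⟨x', u, r, hr, hxend, hxx'⟩ := exists_blockEndsAt hNe hPos hEss hD' hx (k + m)
  obtain ⟨y', v, r', hr', hystart, hyy'⟩ := exists_blockStartsAt hNe hPos hEss hD' hy l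
  obtain ⟨w, z, hwv, hz, hzx⟩ := hL₀ (u, v) x' _ hxend
  have hle := hL (Set.mem_range_self (u, v))
  set M := L₀ (u, v)
  have hstart := hystart.translate (k + m + r + M - (l - r'))
  rw [add_sub_cancel] at hstart
  refine ⟨_, hz.splice_mem hstart hwv, k, k + m + r + M + r', by omega, by push_cast; omega,
    fun i hi => ?_, fun i hi => ?_⟩
  · rw [if_pos (by omega), hzx _ (by omega), hxx' _ (by omega)]
  · rw [if_neg (by omega), hyy' _ (by omega)]
    congr 1
    ring

theorem transGen_of_hasWeakSpecification_SGraphShift {V : Type*}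
    [TopologicalSpace V] [DiscreteTopology V] {Adj : V → V → Prop} {S : V → Set ℕ}
    (hNe : ∀ v, (S v).Nonempty) (hPos : ∀ v, 0 ∉ S v)
    (hEss : ∀ v : V, (∃ u, Adj u v) ∧ (∃ w, Adj v w))
    (h : HasWeakSpecification (closure (SGraphCore Adj S))) (u v : V) :
    Relation.TransGen Adj u v := by
  obtain ⟨N, hN⟩ := hasWeakSpecification_closure_iff.1 h
  have hpt (v : V) : ∃ x ∈ SGraphCore Adj S, x 0 = v := by
    obtain ⟨n, hn⟩ := hNe v
    obtain ⟨x, a, t, hx, rfl, ht0, ht1⟩ := exists_isBlockDecomposition hNe hPos hEss hn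
    have := hx.1 zero_lt_one
    exact ⟨x, mem_SGraphCore_iff_s8.2 ⟨a, t, hx⟩,
      hx.2.2.2 0 0 ht0.le (by simpa [ht0] using this)⟩
  obtain ⟨w, hw⟩ := (hEss u).2
  obtain ⟨x, hx, hx0⟩ := hpt w
  obtain ⟨y, hy, hy0⟩ := hpt v
  obtain ⟨z, hz, p, q, hpq, -, h1, h2⟩ := hN x hx y hy 0 0 1 1
  obtain ⟨a, t, hzd⟩ := mem_SGraphCore_iff_s8.1 hz
  have key := hzd.reflTransGen (show p ≤ q by omega)
  have e1 : z p = w := by simpa [hx0] using h1 0 one_pos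
  have e2 : z q = v := by simpa [hy0] using h2 0 one_pos
  rw [e1, e2] at key
  exact Relation.TransGen.head' hw key

theorem supDeltaFinite_of_hasWeakSpecification_SGraphShift {V : Type*}
    [TopologicalSpace V] [DiscreteTopology V] {Adj : V → V → Prop} {S : V → Set ℕ}
    (hLoop : ∀ v, ¬ Adj v v) (hNe : ∀ v, (S v).Nonempty) (hPos : ∀ v, 0 ∉ S v)
    (hEss : ∀ v : V, (∃ u, Adj u v) ∧ (∃ w, Adj v w))
    (h : HasWeakSpecification (closure (SGraphCore Adj S))) (v : V) :
    SupDeltaFinite (S v) := by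
  obtain ⟨N, hN⟩ := hasWeakSpecification_closure_iff.1 h
  rcases (S v).finite_or_infinite with hfin | hinf
  · exact .inl hfin
  refine .inr ⟨N + 1, fun s _ => ?_⟩
  obtain ⟨n, hn, hsn⟩ := hinf.exists_gt s
  obtain ⟨x, a, t, hx, ha0, ht0, ht1⟩ := exists_isBlockDecomposition hNe hPos hEss hn
  have hxcore := mem_SGraphCore_iff_s8.2 ⟨a, t, hx⟩
  have hne (i : ℤ) (hi : a i = v) : a (i - 1) ≠ v ∧ a (i + 1) ≠ v := by
    have h1 := hx.2.2.1 (i - 1)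
    have h2 := hx.2.2.1 i
    rw [sub_add_cancel] at h1
    exact ⟨fun e => hLoop v (by rwa [e, hi] at h1), fun e => hLoop v (by rwa [e, hi] at h2)⟩
  have hbefore : x (-1) ≠ v := by
    have := hx.1 (show (-1 : ℤ) < 0 by omega)
    rw [hx.2.2.2 (-1) (-1) (by omega) (by simp [ht0])]
    exact (hne 0 ha0).1
  have hafter : x n ≠ v := by
    have := hx.1 (show (1 : ℤ) < 1 + 1 by omega)
    rw [hx.2.2.2 1 n ht1.le (by omega)]
    exact (hne 0 ha0).2
  have hin (k : ℕ) (hk : k < n) : x k = v := by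
    rw [hx.2.2.2 0 k (by omega) (by simp only [zero_add]; omega), ha0]
  obtain ⟨z, hz, p, q, hpq, hqp, h1, h2⟩ := hN x hxcore x hxcore (-1) n (s + 2) 1
  obtain ⟨b, r, h3, h4, h5, h6⟩ := mem_SGraphCore_iff_s8.1 hz
  push_cast at hpq hqp
  have hzp : z p ≠ v := by simpa using (h1 0 (by omega)).trans_ne (by simpa using hbefore)
  have hzq : z q ≠ v := by simpa using (h2 0 one_pos).trans_ne (by simpa using hafter)
  have hzv (k : ℤ) (hk : p < k) (hk' : k ≤ p + s + 1) : z k = v := by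
    obtain ⟨j, rfl⟩ : ∃ j : ℕ, k = p + (j + 1 : ℕ) := ⟨(k - p - 1).toNat, by omega⟩
    rw [h1 _ (by omega), ← hin j (by omega)]
    congr 1
    omega
  obtain ⟨i, hi, hi'⟩ := exists_strictMono_mem_Ico h3 (p + 1)
  have hbi : b i = v := by rw [← h6 i _ hi hi', hzv _ (by omega) (by omega)]
  have hstart : r i = p + 1 := by
    by_contra hc
    exact hzp ((h6 i p (by omega) (by omega)).trans hbi)
  have hlong : p + s + 2 ≤ r (i + 1) := by
    by_contra hc
    have e := h6 (i + 1) _ le_rfl (h3 (lt_add_one _))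
    rw [hzv _ (by omega) (by omega)] at e
    have := h5 i
    rw [hbi, ← e] at this
    exact hLoop v this
  have hshort : r (i + 1) ≤ q := by
    by_contra hc
    exact hzq ((h6 i q (by omega) (by omega)).trans hbi)
  exact ⟨_, hbi ▸ h4 i, by omega, by omega⟩

/-- **Weak specification characterization.**  Let `(G,S)` be an essential
set-equipped graph.  `X(G,S)` has the weak specification property iff `G` is
irreducible and `sup Δ(S_v) < ∞` for every vertex `v`. -/
theorem hasWeakSpecification_SGraphShift_iff {V : Type*} [Fintype V]
    [TopologicalSpace V] [DiscreteTopology V]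
    (Adj : V → V → Prop) (S : V → Set ℕ)
    (hLoop : ∀ v, ¬ Adj v v)
    (hNe : ∀ v, (S v).Nonempty) (hPos : ∀ v, 0 ∉ S v)
    (hEss : ∀ v : V, (∃ u, Adj u v) ∧ (∃ w, Adj v w)) :
    HasWeakSpecification (closure (SGraphCore Adj S)) ↔
      ((∀ u v : V, Relation.TransGen Adj u v) ∧ ∀ v, SupDeltaFinite (S v)) :=
  ⟨fun h => ⟨transGen_of_hasWeakSpecification_SGraphShift hNe hPos hEss h,
      supDeltaFinite_of_hasWeakSpecification_SGraphShift hLoop hNe hPos hEss h⟩,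
    fun h => hasWeakSpecification_SGraphShift_of_transGen hNe hPos hEss h.1 h.2⟩
end
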